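/- arXiv:1610.04674 — 2 statements merged into one kernel-verified Lean document; each statement's English description precedes it below -/
import Mathlib

section
/- (Linear convergence of multi-epoch Compositional-SVRG-1) With parameters γ = μ_f/(32 L_f²), A ≥ 512 B_G⁴ L_F²/μ_f², and K ≥ 512 L_f²/μ_f², the epoch outputs of Compositional-SVRG-1 satisfy E‖x̃_S − x*‖² ≤ (7/8)^S · E‖x̃_0 − x*‖² for every number of epochs S ∈ ℕ. -/
open MeasureTheory ProbabilityTheory
open scoped BigOperators RealInnerProductSpace ENNReal

noncomputable section

/-- `G(x) = (1/m) ∑ⱼ Gⱼ(x)`. -/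
def Gbar {N M m : ℕ} (Gc : Fin m → EuclideanSpace ℝ (Fin N) → EuclideanSpace ℝ (Fin M))
    (x : EuclideanSpace ℝ (Fin N)) : EuclideanSpace ℝ (Fin M) :=
  (m : ℝ)⁻¹ • ∑ j, Gc j x

/-- `∂G(x) = (1/m) ∑ⱼ ∂Gⱼ(x)`. -/
def DGbar {N M m : ℕ}
    (DG : Fin m → EuclideanSpace ℝ (Fin N) → (EuclideanSpace ℝ (Fin N) →L[ℝ] EuclideanSpace ℝ (Fin M)))
    (x : EuclideanSpace ℝ (Fin N)) : EuclideanSpace ℝ (Fin N) →L[ℝ] EuclideanSpace ℝ (Fin M) :=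
  (m : ℝ)⁻¹ • ∑ j, DG j x

/-- `∇F(y) = (1/n) ∑ᵢ ∇Fᵢ(y)`. -/
def gradFbar {M n : ℕ} (gF : Fin n → EuclideanSpace ℝ (Fin M) → EuclideanSpace ℝ (Fin M))
    (y : EuclideanSpace ℝ (Fin M)) : EuclideanSpace ℝ (Fin M) :=
  (n : ℝ)⁻¹ • ∑ i, gF i y

/-- `f(x) = F(G(x)) = (1/n) ∑ᵢ Fᵢ(G(x))`. -/
def fObj {N M m n : ℕ} (Gc : Fin m → EuclideanSpace ℝ (Fin N) → EuclideanSpace ℝ (Fin M))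
    (Fc : Fin n → EuclideanSpace ℝ (Fin M) → ℝ) (x : EuclideanSpace ℝ (Fin N)) : ℝ :=
  (n : ℝ)⁻¹ * ∑ i, Fc i (Gbar Gc x)

/-- `∇f(x) = (∂G(x))ᵀ ∇F(G(x))` (chain rule). -/
def gradf {N M m n : ℕ} (Gc : Fin m → EuclideanSpace ℝ (Fin N) → EuclideanSpace ℝ (Fin M))
    (DG : Fin m → EuclideanSpace ℝ (Fin N) → (EuclideanSpace ℝ (Fin N) →L[ℝ] EuclideanSpace ℝ (Fin M)))
    (gF : Fin n → EuclideanSpace ℝ (Fin M) → EuclideanSpace ℝ (Fin M))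
    (x : EuclideanSpace ℝ (Fin N)) : EuclideanSpace ℝ (Fin N) :=
  ContinuousLinearMap.adjoint (DGbar DG x) (gradFbar gF (Gbar Gc x))

/-- The combined family of all random indices used by multi-epoch
Compositional-SVRG-1 (embedded into `ℕ`): epoch `p.1`, then either one of the
`A` mini-batch indices / the outer index `i` / the index `j` of iteration `q.1`,
or the uniformly chosen output iteration index `r` of the epoch. -/
def allIdx {Ω : Type*} {mN nN : ℕ} (K A : ℕ)
    (a : ℕ → Fin K → Fin A → Ω → Fin mN) (i : ℕ → Fin K → Ω → Fin nN)
    (j : ℕ → Fin K → Ω → Fin mN) (r : ℕ → Ω → Fin K) :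
    ℕ × (Fin K × Fin (A + 2) ⊕ Unit) → Ω → ℕ :=
  fun p ω =>
    match p.2 with
    | Sum.inl q =>
        if h : (q.2 : ℕ) < A then (a p.1 q.1 ⟨(q.2 : ℕ), h⟩ ω : ℕ)
        else if (q.2 : ℕ) = A then (i p.1 q.1 ω : ℕ) else (j p.1 q.1 ω : ℕ)
    | Sum.inr _ => (r p.1 ω : ℕ)

/-- Sums of independent uniform draws from a centred family: the second moments add up. -/
lemma sum_norm_sq_sum_of_sum_eq_zero {E : Type*} [NormedAddCommGroup E] [InnerProductSpace ℝ E]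
    {m : ℕ} (w : Fin m → E) (hw : ∑ c, w c = 0) (A : ℕ) :
    ∑ a : Fin A → Fin m, (m : ℝ) * ‖∑ l, w (a l)‖ ^ 2
      = A * (m : ℝ) ^ A * ∑ c, ‖w c‖ ^ 2 := by
  induction A with
  | zero => simp
  | succ A ih =>
    rw [← (Fin.consEquiv fun _ => Fin m).sum_comp, Fintype.sum_prod_type, Finset.sum_comm]
    have key : ∀ a : Fin A → Fin m,
        ∑ c, (m : ℝ) * ‖∑ l, w ((Fin.consEquiv fun _ => Fin m) (c, a) l)‖ ^ 2
          = m * ∑ c, ‖w c‖ ^ 2 + m * (m * ‖∑ l, w (a l)‖ ^ 2) := by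
      intro a
      have : ∀ c, ‖∑ l, w ((Fin.consEquiv fun _ => Fin m) (c, a) l)‖ ^ 2
          = ‖w c‖ ^ 2 + 2 * ⟪w c, ∑ l, w (a l)⟫ + ‖∑ l, w (a l)‖ ^ 2 := by
        intro c
        rw [Fin.sum_univ_succ, ← norm_add_sq_real]
        simp [Fin.consEquiv]
      simp_rw [this]
      rw [← Finset.mul_sum, Finset.sum_add_distrib, Finset.sum_add_distrib, ← Finset.mul_sum,
        ← sum_inner, hw, inner_zero_left]
      simp
      ring
    simp_rw [key]
    have hA : ∑ a : Fin A → Fin m, (m : ℝ) * (m * ‖∑ l, w (a l)‖ ^ 2)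
        = m * ∑ a : Fin A → Fin m, (m : ℝ) * ‖∑ l, w (a l)‖ ^ 2 := (Finset.mul_sum _ _ _).symm
    rw [Finset.sum_add_distrib, hA, ih]
    simp
    ring

/-- The mean of `A` independent uniform draws has variance at most `1 / A` times the
second moment of one draw. -/
lemma sum_norm_sq_mean_sub_le {E : Type*} [NormedAddCommGroup E] [InnerProductSpace ℝ E]
    {m A : ℕ} (hm : 0 < m) (hA : 0 < A) (u : Fin m → E) {R : ℝ} (hu : ∀ c, ‖u c‖ ^ 2 ≤ R) :
    ∑ a : Fin A → Fin m, ‖(m : ℝ)⁻¹ • ∑ c, u c - (A : ℝ)⁻¹ • ∑ l, u (a l)‖ ^ 2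
      ≤ (m : ℝ) ^ A * (R / A) := by
  have hm' : (0 : ℝ) < m := by exact_mod_cast hm
  have hA' : (0 : ℝ) < A := by exact_mod_cast hA
  set b := (m : ℝ)⁻¹ • ∑ c, u c with hb
  have hub : ∑ c, u c = (m : ℝ) • b := by rw [hb, smul_inv_smul₀ hm'.ne']
  have hw : ∑ c, (u c - b) = 0 := by
    rw [Finset.sum_sub_distrib, hub]; simp [← Nat.cast_smul_eq_nsmul ℝ]
  have h2 : ∑ c, ‖u c - b‖ ^ 2 ≤ m * R := by
    have : ∑ c, ‖u c - b‖ ^ 2 = ∑ c, ‖u c‖ ^ 2 - m * ‖b‖ ^ 2 := by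
      simp_rw [norm_sub_sq_real]
      rw [Finset.sum_add_distrib, Finset.sum_sub_distrib, ← Finset.mul_sum, ← sum_inner, hub,
        real_inner_smul_left, real_inner_self_eq_norm_sq]
      simp
      ring
    have h3 : ∑ c, ‖u c‖ ^ 2 ≤ m * R := by
      simpa using Finset.sum_le_sum (s := Finset.univ) fun c _ => hu c
    nlinarith [mul_nonneg hm'.le (sq_nonneg ‖b‖)]
  have h4 : ∀ a : Fin A → Fin m, ‖b - (A : ℝ)⁻¹ • ∑ l, u (a l)‖ ^ 2
      = ((A : ℝ) ^ 2 * m)⁻¹ * (m * ‖∑ l, (u (a l) - b)‖ ^ 2) := by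
    intro a
    have : b - (A : ℝ)⁻¹ • ∑ l, u (a l) = - ((A : ℝ)⁻¹ • ∑ l, (u (a l) - b)) := by
      rw [Finset.sum_sub_distrib, smul_sub]
      simp [← Nat.cast_smul_eq_nsmul ℝ, smul_smul, hA'.ne']
    rw [this, norm_neg, norm_smul, mul_pow]
    simp
    field_simp
  simp_rw [h4]
  rw [← Finset.mul_sum, sum_norm_sq_sum_of_sum_eq_zero _ hw]
  calc ((A : ℝ) ^ 2 * m)⁻¹ * (A * (m : ℝ) ^ A * ∑ c, ‖u c - b‖ ^ 2)
      ≤ ((A : ℝ) ^ 2 * m)⁻¹ * (A * (m : ℝ) ^ A * (m * R)) := by gcongr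
    _ = _ := by field_simp

/-- Averaging the squared distance after a step along unbiased, bounded directions. -/
lemma sum_norm_sub_smul_sq_le {E ι : Type*} [NormedAddCommGroup E] [InnerProductSpace ℝ E]
    [Fintype ι] (d : ι → E) (w z : E) (γ : ℝ) {R : ℝ}
    (hd : ∑ p, d p = (Fintype.card ι : ℝ) • w) (hR : ∀ p, ‖d p‖ ^ 2 ≤ R) :
    ∑ p, ‖z - γ • d p‖ ^ 2
      ≤ Fintype.card ι * (‖z‖ ^ 2 - 2 * γ * ⟪w, z⟫ + γ ^ 2 * R) := by
  have h : ∀ p, ‖z - γ • d p‖ ^ 2 ≤ (‖z‖ ^ 2 + γ ^ 2 * R) - 2 * γ * ⟪d p, z⟫ := by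
    intro p
    rw [norm_sub_sq_real, norm_smul, real_inner_smul_right, mul_pow, Real.norm_eq_abs, sq_abs,
      real_inner_comm]
    have := mul_le_mul_of_nonneg_left (hR p) (sq_nonneg γ)
    linarith
  refine (Finset.sum_le_sum fun p _ => h p).trans_eq ?_
  rw [Finset.sum_sub_distrib, ← Finset.mul_sum, ← sum_inner, hd, real_inner_smul_left]
  simp
  ring

/-- The inner estimate `Ĝ` of `G(x)` with snapshot `y` and mini-batch `a`. -/
def innerEst {N M m A : ℕ} (Gc : Fin m → EuclideanSpace ℝ (Fin N) → EuclideanSpace ℝ (Fin M))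
    (a : Fin A → Fin m) (x y : EuclideanSpace ℝ (Fin N)) : EuclideanSpace ℝ (Fin M) :=
  Gbar Gc y - (A : ℝ)⁻¹ • ∑ l, (Gc (a l) y - Gc (a l) x)

/-- The update direction at `x` with snapshot `y` and sampled indices `v = (a, i, j)`. -/
def svrgDir {N M m n A : ℕ} (Gc : Fin m → EuclideanSpace ℝ (Fin N) → EuclideanSpace ℝ (Fin M))
    (DG : Fin m → EuclideanSpace ℝ (Fin N) →
      (EuclideanSpace ℝ (Fin N) →L[ℝ] EuclideanSpace ℝ (Fin M)))
    (gF : Fin n → EuclideanSpace ℝ (Fin M) → EuclideanSpace ℝ (Fin M))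
    (v : (Fin A → Fin m) × Fin n × Fin m) (x y : EuclideanSpace ℝ (Fin N)) :
    EuclideanSpace ℝ (Fin N) :=
  ContinuousLinearMap.adjoint (DG v.2.2 x) (gF v.2.1 (innerEst Gc v.1 x y))
    - ContinuousLinearMap.adjoint (DG v.2.2 y) (gF v.2.1 (Gbar Gc y)) + gradf Gc DG gF y

section Deterministic

variable {N M m n A : ℕ}
  {Gc : Fin m → EuclideanSpace ℝ (Fin N) → EuclideanSpace ℝ (Fin M)}
  {DG : Fin m → EuclideanSpace ℝ (Fin N) →
    (EuclideanSpace ℝ (Fin N) →L[ℝ] EuclideanSpace ℝ (Fin M))}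
  {Fc : Fin n → EuclideanSpace ℝ (Fin M) → ℝ}
  {gF : Fin n → EuclideanSpace ℝ (Fin M) → EuclideanSpace ℝ (Fin M)}
  {BG LF Lf μf : ℝ} {xstar : EuclideanSpace ℝ (Fin N)}

lemma norm_Gc_sub_le (hDG : ∀ j x, HasFDerivAt (Gc j) (DG j x) x)
    (hBGb : ∀ j x, ‖DG j x‖ ≤ BG) (j : Fin m) (x y : EuclideanSpace ℝ (Fin N)) :
    ‖Gc j y - Gc j x‖ ≤ BG * ‖y - x‖ :=
  convex_univ.norm_image_sub_le_of_norm_hasFDerivWithin_le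
    (fun z _ => (hDG j z).hasFDerivWithinAt) (fun z _ => hBGb j z) trivial trivial

lemma norm_DGbar_le (hm : 0 < m) (hBGb : ∀ j x, ‖DG j x‖ ≤ BG) (x : EuclideanSpace ℝ (Fin N)) :
    ‖DGbar DG x‖ ≤ BG := by
  have hm' : (0 : ℝ) < m := by exact_mod_cast hm
  have h : ‖∑ j, DG j x‖ ≤ m * BG := by
    simpa using norm_sum_le_of_le Finset.univ fun j _ => hBGb j x
  rw [DGbar, norm_smul, norm_inv, Real.norm_natCast]
  calc (m : ℝ)⁻¹ * ‖∑ j, DG j x‖ ≤ (m : ℝ)⁻¹ * (m * BG) := by gcongr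
    _ = BG := by field_simp

lemma norm_gradFbar_sub_le (hn : 0 < n) (hLFb : ∀ i u v, ‖gF i u - gF i v‖ ≤ LF * ‖u - v‖)
    (u v : EuclideanSpace ℝ (Fin M)) :
    ‖gradFbar gF u - gradFbar gF v‖ ≤ LF * ‖u - v‖ := by
  have hn' : (0 : ℝ) < n := by exact_mod_cast hn
  have h : ‖∑ i, (gF i u - gF i v)‖ ≤ n * (LF * ‖u - v‖) := by
    simpa using norm_sum_le_of_le Finset.univ fun i _ => hLFb i u v
  rw [gradFbar, gradFbar, ← smul_sub, ← Finset.sum_sub_distrib, norm_smul, norm_inv,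
    Real.norm_natCast]
  calc (n : ℝ)⁻¹ * ‖∑ i, (gF i u - gF i v)‖ ≤ (n : ℝ)⁻¹ * (n * (LF * ‖u - v‖)) := by gcongr
    _ = _ := by field_simp

/-- Averaging `(∂Gⱼ(x))ᵀ ∇Fᵢ(g)` over `(i, j)` gives `(∂G(x))ᵀ ∇F(g)`. -/
lemma sum_adjoint_apply (hm : 0 < m) (hn : 0 < n) (x : EuclideanSpace ℝ (Fin N))
    (g : EuclideanSpace ℝ (Fin M)) :
    ∑ p : Fin n × Fin m, ContinuousLinearMap.adjoint (DG p.2 x) (gF p.1 g)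
      = ((n : ℝ) * m) • ContinuousLinearMap.adjoint (DGbar DG x) (gradFbar gF g) := by
  have hm' : (m : ℝ) ≠ 0 := by exact_mod_cast hm.ne'
  have hn' : (n : ℝ) ≠ 0 := by exact_mod_cast hn.ne'
  have h1 : ContinuousLinearMap.adjoint (DGbar DG x)
      = (m : ℝ)⁻¹ • ∑ j, ContinuousLinearMap.adjoint (DG j x) := by
    simp [DGbar]
  rw [h1, gradFbar, Fintype.sum_prod_type, map_smul, map_sum]
  simp only [smul_apply, sum_apply, ← Finset.smul_sum,
    smul_smul]
  rw [show (n : ℝ) * m * ((n : ℝ)⁻¹ * (m : ℝ)⁻¹) = 1 by field_simp, one_smul]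

lemma norm_gradf_sub_le (hm : 0 < m) (hn : 0 < n)
    (hLfb : ∀ (x y : EuclideanSpace ℝ (Fin N)) (i : Fin n) (j : Fin m),
      ‖ContinuousLinearMap.adjoint (DG j x) (gF i (Gbar Gc x))
        - ContinuousLinearMap.adjoint (DG j y) (gF i (Gbar Gc y))‖ ≤ Lf * ‖x - y‖)
    (x y : EuclideanSpace ℝ (Fin N)) :
    ‖gradf Gc DG gF x - gradf Gc DG gF y‖ ≤ Lf * ‖x - y‖ := by
  have hm' : (0 : ℝ) < m := by exact_mod_cast hm
  have hn' : (0 : ℝ) < n := by exact_mod_cast hn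
  have h : ‖((n : ℝ) * m) • (gradf Gc DG gF x - gradf Gc DG gF y)‖
      ≤ (n * m) * (Lf * ‖x - y‖) := by
    rw [smul_sub, gradf, gradf, ← sum_adjoint_apply hm hn, ← sum_adjoint_apply hm hn,
      ← Finset.sum_sub_distrib]
    simpa using norm_sum_le_of_le Finset.univ fun (p : Fin n × Fin m) _ => hLfb x y p.1 p.2
  rw [norm_smul, Real.norm_of_nonneg (by positivity)] at h
  exact le_of_mul_le_mul_left h (by positivity)

lemma gradf_eq_zero (hLf : 0 < Lf) (hμf : 0 < μf)
    (hLip : ∀ x y, ‖gradf Gc DG gF x - gradf Gc DG gF y‖ ≤ Lf * ‖x - y‖)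
    (hsc : ∀ x y : EuclideanSpace ℝ (Fin N),
      fObj Gc Fc y ≥ fObj Gc Fc x + ⟪gradf Gc DG gF x, y - x⟫ + μf / 2 * ‖y - x‖ ^ 2)
    (hxstar : ∀ x, fObj Gc Fc xstar ≤ fObj Gc Fc x) : gradf Gc DG gF xstar = 0 := by
  set g := gradf Gc DG gF xstar with hg
  set t : ℝ := (2 * Lf)⁻¹ with ht
  have ht0 : 0 < t := by positivity
  have h1 := hsc (xstar - t • g) xstar
  have h2 := hxstar (xstar - t • g)
  have h3 := hLip (xstar - t • g) xstar
  rw [sub_sub_cancel_left, norm_neg, norm_smul, Real.norm_of_nonneg ht0.le] at h3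
  rw [sub_sub_cancel, real_inner_smul_right] at h1
  have h4 : ⟪gradf Gc DG gF (xstar - t • g), g⟫ ≤ 0 := by
    have : 0 ≤ μf / 2 * ‖t • g‖ ^ 2 := by positivity
    by_contra! hc
    nlinarith [mul_pos ht0 hc]
  have h5 : ‖g‖ ^ 2 ≤ ‖gradf Gc DG gF (xstar - t • g) - g‖ * ‖g‖ := by
    have h6 := neg_le_of_abs_le (abs_real_inner_le_norm (gradf Gc DG gF (xstar - t • g) - g) g)
    rw [inner_sub_left, real_inner_self_eq_norm_sq] at h6
    linarith
  have h7 : Lf * (t * ‖g‖) = ‖g‖ / 2 := by rw [ht]; field_simp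
  rw [h7] at h3
  have h8 := mul_le_mul_of_nonneg_right h3 (norm_nonneg g)
  have h9 : ‖g‖ ^ 2 ≤ 0 := by nlinarith
  exact norm_eq_zero.1 (pow_eq_zero_iff two_ne_zero |>.1 (le_antisymm h9 (sq_nonneg _)))

lemma mul_norm_sq_le_inner_gradf (hg : gradf Gc DG gF xstar = 0)
    (hsc : ∀ x y : EuclideanSpace ℝ (Fin N),
      fObj Gc Fc y ≥ fObj Gc Fc x + ⟪gradf Gc DG gF x, y - x⟫ + μf / 2 * ‖y - x‖ ^ 2)
    (x : EuclideanSpace ℝ (Fin N)) :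
    μf * ‖x - xstar‖ ^ 2 ≤ ⟪gradf Gc DG gF x, x - xstar⟫ := by
  have h1 := hsc x xstar
  have h2 := hsc xstar x
  rw [hg, inner_zero_left] at h2
  rw [← neg_sub x xstar, inner_neg_right, norm_neg] at h1
  linarith

lemma strongConvexity_le_lipschitz (hN : 0 < N) (hg : gradf Gc DG gF xstar = 0)
    (hLip : ∀ x y, ‖gradf Gc DG gF x - gradf Gc DG gF y‖ ≤ Lf * ‖x - y‖)
    (hmono : ∀ x, μf * ‖x - xstar‖ ^ 2 ≤ ⟪gradf Gc DG gF x, x - xstar⟫) : μf ≤ Lf := by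
  have : Nonempty (Fin N) := ⟨⟨0, hN⟩⟩
  obtain ⟨x, hx⟩ := exists_ne xstar
  have hx' : 0 < ‖x - xstar‖ := norm_pos_iff.2 (sub_ne_zero.2 hx)
  have h1 := hLip x xstar
  rw [hg, sub_zero] at h1
  have h2 := (hmono x).trans (real_inner_le_norm _ _)
  have h3 := mul_le_mul_of_nonneg_right h1 hx'.le
  exact le_of_mul_le_mul_right (by nlinarith) (pow_pos hx' 2)

lemma sum_norm_innerEst_sub_sq_le (hm : 0 < m) (hA : 0 < A)
    (hDG : ∀ j x, HasFDerivAt (Gc j) (DG j x) x)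
    (hBGb : ∀ j x, ‖DG j x‖ ≤ BG) (x y : EuclideanSpace ℝ (Fin N)) :
    ∑ a : Fin A → Fin m, ‖innerEst Gc a x y - Gbar Gc x‖ ^ 2
      ≤ (m : ℝ) ^ A * (BG ^ 2 * ‖x - y‖ ^ 2 / A) := by
  have h := sum_norm_sq_mean_sub_le hm hA (fun c => Gc c y - Gc c x)
    (R := BG ^ 2 * ‖x - y‖ ^ 2) (fun c => by
      rw [← mul_pow, norm_sub_rev x y]
      gcongr
      exact norm_Gc_sub_le hDG hBGb c x y)
  refine le_of_eq_of_le (Finset.sum_congr rfl fun a _ => ?_) h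
  rw [innerEst, Gbar, Gbar, Finset.sum_sub_distrib (fun c => Gc c y), smul_sub]
  congr 2
  abel

lemma norm_innerEst_sub_sq_le (hm : 0 < m) (hA : 0 < A)
    (hDG : ∀ j x, HasFDerivAt (Gc j) (DG j x) x)
    (hBGb : ∀ j x, ‖DG j x‖ ≤ BG) (a : Fin A → Fin m) (x y : EuclideanSpace ℝ (Fin N)) :
    ‖innerEst Gc a x y - Gbar Gc x‖ ^ 2 ≤ (m : ℝ) ^ A * (BG ^ 2 * ‖x - y‖ ^ 2 / A) :=
  (Finset.single_le_sum (f := fun a => ‖innerEst Gc a x y - Gbar Gc x‖ ^ 2)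
    (fun _ _ => sq_nonneg _) (Finset.mem_univ a)).trans
    (sum_norm_innerEst_sub_sq_le hm hA hDG hBGb x y)

lemma norm_svrgDir_sq_le (hBG : 0 < BG)
    (hBGb : ∀ j x, ‖DG j x‖ ≤ BG)
    (hLFb : ∀ i u v, ‖gF i u - gF i v‖ ≤ LF * ‖u - v‖)
    (hLfb : ∀ (x y : EuclideanSpace ℝ (Fin N)) (i : Fin n) (j : Fin m),
      ‖ContinuousLinearMap.adjoint (DG j x) (gF i (Gbar Gc x))
        - ContinuousLinearMap.adjoint (DG j y) (gF i (Gbar Gc y))‖ ≤ Lf * ‖x - y‖)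
    (hLip : ∀ x y, ‖gradf Gc DG gF x - gradf Gc DG gF y‖ ≤ Lf * ‖x - y‖)
    (hg : gradf Gc DG gF xstar = 0)
    (v : (Fin A → Fin m) × Fin n × Fin m) (x y : EuclideanSpace ℝ (Fin N)) :
    ‖svrgDir Gc DG gF v x y‖ ^ 2 ≤ 3 * (BG ^ 2 * LF ^ 2 * ‖innerEst Gc v.1 x y - Gbar Gc x‖ ^ 2
      + Lf ^ 2 * ‖x - y‖ ^ 2 + Lf ^ 2 * ‖y - xstar‖ ^ 2) := by
  obtain ⟨a, i, j⟩ := v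
  set δ := ‖innerEst Gc a x y - Gbar Gc x‖
  have hdec : svrgDir Gc DG gF (a, i, j) x y
      = ContinuousLinearMap.adjoint (DG j x) (gF i (innerEst Gc a x y) - gF i (Gbar Gc x))
        + (ContinuousLinearMap.adjoint (DG j x) (gF i (Gbar Gc x))
          - ContinuousLinearMap.adjoint (DG j y) (gF i (Gbar Gc y)))
        + (gradf Gc DG gF y - gradf Gc DG gF xstar) := by
    rw [hg, svrgDir, map_sub]
    abel
  have h1 : ‖ContinuousLinearMap.adjoint (DG j x)
      (gF i (innerEst Gc a x y) - gF i (Gbar Gc x))‖ ≤ BG * (LF * δ) := by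
    refine (ContinuousLinearMap.le_opNorm _ _).trans ?_
    rw [LinearIsometryEquiv.norm_map]
    gcongr
    exacts [hBGb j x, hLFb i _ _]
  have h4 : ‖svrgDir Gc DG gF (a, i, j) x y‖
      ≤ BG * (LF * δ) + Lf * ‖x - y‖ + Lf * ‖y - xstar‖ := by
    rw [hdec]
    exact (norm_add₃_le).trans (add_le_add (add_le_add h1 (hLfb x y i j)) (hLip y xstar))
  have h5 := pow_le_pow_left₀ (norm_nonneg _) h4 2
  refine h5.trans ?_
  nlinarith [sq_nonneg (BG * (LF * δ) - Lf * ‖x - y‖), sq_nonneg (BG * (LF * δ) - Lf * ‖y - xstar‖),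
    sq_nonneg (Lf * ‖x - y‖ - Lf * ‖y - xstar‖)]

/-- The numerical estimate that fixes the constants of the one-step contraction. -/
lemma step_scalar_bound {A γ D D₀ e : ℝ} (hA : 0 < A) (hBG : 0 < BG) (hLf : 0 < Lf)
    (hμf : 0 < μf) (hμL : μf ≤ Lf) (hγ : γ = μf / (32 * Lf ^ 2))
    (hAc : 512 * BG ^ 4 * LF ^ 2 / μf ^ 2 ≤ A)
    (hD : 0 ≤ D) (hD₀ : 0 ≤ D₀) (he : 0 ≤ e) (heD : e ≤ 2 * D + 2 * D₀) :
    (D - 2 * γ * (μf * D) + γ * (μf / 8 * D) + γ ^ 2 * (3 * (Lf ^ 2 * e + Lf ^ 2 * D₀)))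
      + (γ * (8 / μf * (BG ^ 2 * LF ^ 2)) + γ ^ 2 * (3 * (BG ^ 2 * LF ^ 2))) * (BG ^ 2 * e / A)
      ≤ (1 - γ * μf) * D + γ * μf / 2 * D₀ := by
  have hγ0 : 0 < γ := by rw [hγ]; positivity
  have hγL : γ * Lf ^ 2 = μf / 32 := by rw [hγ]; field_simp
  clear hγ
  obtain ⟨κ, hκ⟩ : ∃ κ, κ = BG ^ 4 * LF ^ 2 / A := ⟨_, rfl⟩
  have hκ1 : κ ≤ μf ^ 2 / 512 := by
    rw [div_le_iff₀ (by positivity)] at hAc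
    rw [hκ, div_le_iff₀ hA]
    linarith
  have hβe : (γ * (8 / μf * (BG ^ 2 * LF ^ 2)) + γ ^ 2 * (3 * (BG ^ 2 * LF ^ 2)))
      * (BG ^ 2 * e / A) = (8 * γ / μf * κ + 3 * γ ^ 2 * κ) * e := by
    rw [hκ]; field_simp
  have h1 : 8 * γ / μf * κ ≤ γ * μf / 64 := by
    calc 8 * γ / μf * κ ≤ 8 * γ / μf * (μf ^ 2 / 512) := by gcongr
      _ = γ * μf / 64 := by field_simp; norm_num
  have hη : 0 < γ * μf := by positivity
  have h2 : 3 * γ ^ 2 * κ ≤ γ * μf / 512 := by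
    have : κ ≤ Lf ^ 2 / 512 := hκ1.trans (by gcongr)
    calc 3 * γ ^ 2 * κ ≤ 3 * γ ^ 2 * (Lf ^ 2 / 512) := by gcongr
      _ = 3 * γ * (γ * Lf ^ 2) / 512 := by ring
      _ ≤ γ * μf / 512 := by rw [hγL]; linarith
  have h3 : γ ^ 2 * (3 * (Lf ^ 2 * e + Lf ^ 2 * D₀)) = 3 / 32 * (γ * μf) * (e + D₀) := by
    calc _ = 3 * γ * (γ * Lf ^ 2) * (e + D₀) := by ring
      _ = _ := by rw [hγL]; ring
  have h4 : (8 * γ / μf * κ + 3 * γ ^ 2 * κ) * e ≤ (γ * μf / 64 + γ * μf / 512) * e := by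
    gcongr
  have h5 := mul_le_mul_of_nonneg_left heD hη.le
  have h6 := mul_nonneg hη.le hD
  have h7 := mul_nonneg hη.le hD₀
  rw [hβe, h3]
  linarith

/-- One-step contraction, averaged over the sampled indices. -/
lemma sum_norm_step_sub_sq_le (hm : 0 < m) (hn : 0 < n) (hA : 0 < A)
    (hDG : ∀ j x, HasFDerivAt (Gc j) (DG j x) x)
    (hBG : 0 < BG) (hBGb : ∀ j x, ‖DG j x‖ ≤ BG)
    (hLF : 0 < LF) (hLFb : ∀ i u v, ‖gF i u - gF i v‖ ≤ LF * ‖u - v‖)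
    (hLf : 0 < Lf) (hLfb : ∀ (x y : EuclideanSpace ℝ (Fin N)) (i : Fin n) (j : Fin m),
      ‖ContinuousLinearMap.adjoint (DG j x) (gF i (Gbar Gc x))
        - ContinuousLinearMap.adjoint (DG j y) (gF i (Gbar Gc y))‖ ≤ Lf * ‖x - y‖)
    (hμf : 0 < μf) (hμL : μf ≤ Lf)
    (hmono : ∀ x, μf * ‖x - xstar‖ ^ 2 ≤ ⟪gradf Gc DG gF x, x - xstar⟫)
    (hg : gradf Gc DG gF xstar = 0)
    {γ : ℝ} (hγ : γ = μf / (32 * Lf ^ 2))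
    (hAc : 512 * BG ^ 4 * LF ^ 2 / μf ^ 2 ≤ (A : ℝ))
    (x y : EuclideanSpace ℝ (Fin N)) :
    ∑ v : (Fin A → Fin m) × Fin n × Fin m, ‖x - γ • svrgDir Gc DG gF v x y - xstar‖ ^ 2
      ≤ ((m : ℝ) ^ A * (n * m)) *
        ((1 - γ * μf) * ‖x - xstar‖ ^ 2 + γ * μf / 2 * ‖y - xstar‖ ^ 2) := by
  have hLip := norm_gradf_sub_le hm hn hLfb
  have hA' : (0 : ℝ) < A := by exact_mod_cast hA
  have hγ0 : 0 < γ := by rw [hγ]; positivity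
  set z := x - xstar with hz
  set D := ‖z‖ ^ 2 with hD
  set D₀ := ‖y - xstar‖ ^ 2 with hD₀
  set e := ‖x - y‖ ^ 2 with he
  set α := D - 2 * γ * (μf * D) + γ * (μf / 8 * D) + γ ^ 2 * (3 * (Lf ^ 2 * e + Lf ^ 2 * D₀))
    with hα
  set β := γ * (8 / μf * (BG ^ 2 * LF ^ 2)) + γ ^ 2 * (3 * (BG ^ 2 * LF ^ 2)) with hβ
  have hβ0 : 0 ≤ β := by positivity
  have hinner : ∀ a : Fin A → Fin m,
      ∑ p : Fin n × Fin m, ‖x - γ • svrgDir Gc DG gF (a, p) x y - xstar‖ ^ 2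
        ≤ (n * m) * (α + β * ‖innerEst Gc a x y - Gbar Gc x‖ ^ 2) := by
    intro a
    set δ := ‖innerEst Gc a x y - Gbar Gc x‖ with hδ
    set w := ContinuousLinearMap.adjoint (DGbar DG x) (gradFbar gF (innerEst Gc a x y)) with hw
    have hsum : ∑ p : Fin n × Fin m, svrgDir Gc DG gF (a, p) x y
        = (Fintype.card (Fin n × Fin m) : ℝ) • w := by
      simp only [svrgDir]
      rw [Finset.sum_add_distrib, Finset.sum_sub_distrib, sum_adjoint_apply hm hn,
        sum_adjoint_apply hm hn, Finset.sum_const, Finset.card_univ, ← Nat.cast_smul_eq_nsmul ℝ]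
      simp [gradf, hw]
    have h1 := sum_norm_sub_smul_sq_le _ w z γ hsum
      (R := 3 * (BG ^ 2 * LF ^ 2 * δ ^ 2 + Lf ^ 2 * e + Lf ^ 2 * D₀)) (fun p => norm_svrgDir_sq_le hBG hBGb hLFb hLfb hLip hg (a, p) x y)
    have hcard : (Fintype.card (Fin n × Fin m) : ℝ) = n * m := by simp
    rw [hcard] at h1
    have h2 : ⟪gradf Gc DG gF x, z⟫ - BG * (LF * δ) * ‖z‖ ≤ ⟪w, z⟫ := by
      have h3 : w - gradf Gc DG gF x = ContinuousLinearMap.adjoint (DGbar DG x)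
          (gradFbar gF (innerEst Gc a x y) - gradFbar gF (Gbar Gc x)) := by
        rw [map_sub, hw, gradf]
      have h4 : ‖w - gradf Gc DG gF x‖ ≤ BG * (LF * δ) := by
        rw [h3]
        refine (ContinuousLinearMap.le_opNorm _ _).trans ?_
        rw [LinearIsometryEquiv.norm_map]
        gcongr
        exacts [norm_DGbar_le hm hBGb x, norm_gradFbar_sub_le hn hLFb _ _]
      have h5 := neg_le_of_abs_le (abs_real_inner_le_norm (w - gradf Gc DG gF x) z)
      rw [inner_sub_left] at h5
      have := mul_le_mul_of_nonneg_right h4 (norm_nonneg z)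
      linarith
    have hyoung : 2 * (BG * (LF * δ) * ‖z‖) ≤ μf / 8 * D + 8 / μf * (BG ^ 2 * LF ^ 2) * δ ^ 2 := by
      have h6 : μf / 8 * D + 8 / μf * (BG ^ 2 * LF ^ 2) * δ ^ 2 - 2 * (BG * (LF * δ) * ‖z‖)
          = (μf * ‖z‖ - 8 * (BG * (LF * δ))) ^ 2 / (8 * μf) := by
        rw [hD]; field_simp; ring
      have : 0 ≤ (μf * ‖z‖ - 8 * (BG * (LF * δ))) ^ 2 / (8 * μf) := by positivity
      linarith
    simp_rw [sub_right_comm x _ xstar]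
    refine h1.trans (mul_le_mul_of_nonneg_left ?_ (by positivity))
    have h7 := hmono x
    have h8 : -⟪w, z⟫ ≤ BG * (LF * δ) * ‖z‖ - μf * D := by linarith
    have h9 : -(2 * γ * ⟪w, z⟫)
        ≤ γ * (μf / 8 * D + 8 / μf * (BG ^ 2 * LF ^ 2) * δ ^ 2) - 2 * γ * (μf * D) := by
      have := mul_le_mul_of_nonneg_left h8 (by positivity : 0 ≤ 2 * γ)
      have := mul_le_mul_of_nonneg_left hyoung hγ0.le
      linarith
    rw [hα, hβ]
    linarith
  have hsum := Finset.sum_le_sum (s := Finset.univ) fun a _ => hinner a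
  rw [← Fintype.sum_prod_type' (f := fun (a : Fin A → Fin m) (p : Fin n × Fin m) =>
    ‖x - γ • svrgDir Gc DG gF (a, p) x y - xstar‖ ^ 2)] at hsum
  refine hsum.trans ?_
  rw [← Finset.mul_sum, Finset.sum_add_distrib, ← Finset.mul_sum]
  have hvar := mul_le_mul_of_nonneg_left (sum_norm_innerEst_sub_sq_le hm hA hDG hBGb x y) hβ0
  have hαs : ∑ _a : Fin A → Fin m, α = (m : ℝ) ^ A * α := by simp
  rw [hαs]
  have he2 : e ≤ 2 * D + 2 * D₀ := by
    have h1 : ‖x - y‖ ≤ ‖z‖ + ‖y - xstar‖ := by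
      rw [hz, ← sub_sub_sub_cancel_right x y xstar]
      exact norm_sub_le _ _
    have h2 := pow_le_pow_left₀ (norm_nonneg _) h1 2
    linarith [add_sq_le (a := ‖z‖) (b := ‖y - xstar‖)]
  have hscal : α + β * (BG ^ 2 * e / A) ≤ (1 - γ * μf) * D + γ * μf / 2 * D₀ :=
    step_scalar_bound hA' hBG hLf hμf hμL hγ hAc (sq_nonneg _) (sq_nonneg _) (sq_nonneg _) he2
  calc (n * m : ℝ) * ((m : ℝ) ^ A * α
        + β * ∑ a : Fin A → Fin m, ‖innerEst Gc a x y - Gbar Gc x‖ ^ 2)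
      ≤ (n * m : ℝ) * ((m : ℝ) ^ A * α + β * ((m : ℝ) ^ A * (BG ^ 2 * e / A))) := by gcongr
    _ = ((m : ℝ) ^ A * (n * m)) * (α + β * (BG ^ 2 * e / A)) := by ring
    _ ≤ _ := by gcongr

end Deterministic

section Sampling

lemma indepFun_prodMk_right {Ω α β δ : Type*} [MeasurableSpace Ω] [MeasurableSpace α]
    [MeasurableSpace β] [MeasurableSpace δ] {μ : Measure Ω} [IsProbabilityMeasure μ]
    {f : Ω → α} {g : Ω → β} {h : Ω → δ} (hf : Measurable f) (hg : Measurable g)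
    (hh : AEMeasurable h μ) (hfg : IndepFun f g μ)
    (hfgh : IndepFun (fun ω => (f ω, g ω)) h μ) : IndepFun f (fun ω => (g ω, h ω)) μ := by
  have hgh : IndepFun g h μ := hfgh.comp measurable_snd measurable_id
  rw [indepFun_iff_map_prod_eq_prod_map_map hf.aemeasurable hg.aemeasurable] at hfg
  rw [indepFun_iff_map_prod_eq_prod_map_map hg.aemeasurable hh] at hgh
  rw [indepFun_iff_map_prod_eq_prod_map_map (hf.prodMk hg).aemeasurable hh, hfg] at hfgh
  have := Measure.isProbabilityMeasure_map (μ := μ) hf.aemeasurable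
  have := Measure.isProbabilityMeasure_map (μ := μ) hg.aemeasurable
  have := Measure.isProbabilityMeasure_map (μ := μ) hh
  rw [indepFun_iff_map_prod_eq_prod_map_map hf.aemeasurable (hg.aemeasurable.prodMk hh), hgh,
    ← Measure.prodAssoc_prod, ← hfgh,
    AEMeasurable.map_map_of_aemeasurable (MeasurableEquiv.measurable _).aemeasurable
      ((hf.prodMk hg).aemeasurable.prodMk hh)]
  rfl

lemma measurable_apply_of_countable {α β C : Type*} [MeasurableSpace α] [MeasurableSpace β]
    [MeasurableSpace C] [Countable C] [MeasurableSingletonClass C] {F : C → α → β}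
    (hF : ∀ v, Measurable (F v)) {c : α → C} (hc : Measurable c) :
    Measurable fun ω => F (c ω) ω :=
  (measurable_from_prod_countable_right (f := fun p : C × α => F p.1 p.2) hF).comp
    (hc.prodMk measurable_id)

lemma aemeasurable_apply_of_countable {Ω α β C : Type*} [MeasurableSpace Ω] {μ : Measure Ω}
    [MeasurableSpace α] [MeasurableSpace β]
    [MeasurableSpace C] [Countable C] [MeasurableSingletonClass C] {F : C → α → β}
    (hF : ∀ v, Measurable (F v)) {c : Ω → C} (hc : Measurable c) {Z : Ω → α}
    (hZ : AEMeasurable Z μ) : AEMeasurable (fun ω => F (c ω) (Z ω)) μ :=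
  (measurable_from_prod_countable_right (f := fun p : C × α => F p.1 p.2) hF).comp_aemeasurable
    (hc.aemeasurable.prodMk hZ)

/-- Averaging over a uniform sample that is independent of the state. -/
lemma integral_uniform_apply {Ω α C : Type*} [MeasurableSpace Ω] {μ : Measure Ω}
    [IsProbabilityMeasure μ] [MeasurableSpace α] [Fintype C] [MeasurableSpace C]
    [MeasurableSingletonClass C] {c : Ω → C} {Z : Ω → α} (hc : Measurable c)
    (hZ : AEMeasurable Z μ) (hind : IndepFun c Z μ) {p : ℝ} (hunif : ∀ v, μ.real (c ⁻¹' {v}) = p)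
    {φ : C → α → ℝ} (hφ : ∀ v, Measurable (φ v))
    (hint : ∀ v, Integrable (fun ω => φ v (Z ω)) μ) :
    ∫ ω, φ (c ω) (Z ω) ∂μ = p * ∑ v, ∫ ω, φ v (Z ω) ∂μ := by
  classical
  have hsplit : ∀ ω, φ (c ω) (Z ω) = ∑ v, Set.indicator {v} (1 : C → ℝ) (c ω) * φ v (Z ω) := by
    intro ω
    rw [Finset.sum_eq_single (c ω)]
    · simp
    · intro v _ hv
      simp [Set.indicator_of_notMem, hv.symm]
    · simp
  have hterm : ∀ v, ∫ ω, Set.indicator {v} (1 : C → ℝ) (c ω) * φ v (Z ω) ∂μ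
      = p * ∫ ω, φ v (Z ω) ∂μ := by
    intro v
    have hm : Measurable (Set.indicator {v} (1 : C → ℝ)) :=
      measurable_one.indicator (measurableSet_singleton v)
    rw [hind.integral_fun_comp_mul_comp hc.aemeasurable hZ hm.aestronglyMeasurable
      (hφ v).aestronglyMeasurable]
    congr 1
    rw [← hunif v, ← integral_indicator_one (hc (measurableSet_singleton v))]
    rfl
  simp_rw [hsplit]
  rw [integral_finsetSum, Finset.mul_sum]
  · exact Finset.sum_congr rfl fun v _ => hterm v
  · intro v _
    have : (fun ω => Set.indicator {v} (1 : C → ℝ) (c ω) * φ v (Z ω))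
        = Set.indicator (c ⁻¹' {v}) fun ω => φ v (Z ω) := by
      ext ω
      by_cases h : c ω = v <;> simp [Set.indicator, h]
    rw [this]
    exact (hint v).indicator (hc (measurableSet_singleton v))

section History

variable {Ω E P : Type*} [MeasurableSpace E] {I : P → Ω → ℕ} {x₀ : Ω → E}

/-- The initial point together with the indices in `S`. -/
def history (I : P → Ω → ℕ) (x₀ : Ω → E) (S : Finset P) (ω : Ω) : (S → ℕ) × E :=
  (fun p => I p ω, x₀ ω)

/-- The σ-algebra generated by `history I x₀ S`. -/
@[reducible] def historySigma (I : P → Ω → ℕ) (x₀ : Ω → E) (S : Finset P) : MeasurableSpace Ω :=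
  MeasurableSpace.comap (history I x₀ S) inferInstance

lemma measurable_index_history {S : Finset P} {p : P} (hp : p ∈ S) :
    Measurable[historySigma I x₀ S] (I p) :=
  ((measurable_pi_apply (⟨p, hp⟩ : S)).comp measurable_fst).comp
    (comap_measurable (history I x₀ S))

lemma measurable_init_history {S : Finset P} : Measurable[historySigma I x₀ S] x₀ :=
  measurable_snd.comp (comap_measurable (history I x₀ S))

lemma historySigma_mono {S T : Finset P} (h : S ⊆ T) :
    historySigma I x₀ S ≤ historySigma I x₀ T := by
  let _ : MeasurableSpace Ω := historySigma I x₀ T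
  exact Measurable.comap_le (Measurable.prodMk
    (measurable_pi_lambda _ fun p => measurable_index_history (h p.2)) measurable_init_history)

lemma measurable_of_encode {J C : Type*} [Finite J] [MeasurableSpace C] [Nonempty C]
    (g : J → P) {S : Finset P} (hg : ∀ q, g q ∈ S) {enc : C → J → ℕ}
    (henc : Function.Injective enc) {c : Ω → C} (hc : ∀ ω q, enc (c ω) q = I (g q) ω) :
    Measurable[historySigma I x₀ S] c := by
  have h2 : Function.invFun enc ∘ (fun ω q => I (g q) ω) = c := by
    ext1 ω
    rw [Function.comp_apply, ← funext (hc ω)]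
    exact Function.leftInverse_invFun henc (c ω)
  rw [← h2]
  let _ : MeasurableSpace Ω := historySigma I x₀ S
  exact (Measurable.of_discrete (f := Function.invFun enc)).comp
    (measurable_pi_lambda _ fun q => measurable_index_history (hg q))

end History

variable {Ω E P : Type*} [MeasurableSpace Ω] [MeasurableSpace E] {μ : Measure Ω}
  {I : P → Ω → ℕ} {x₀ : Ω → E}

lemma aemeasurable_of_history (hI : ∀ p, Measurable (I p)) (hx₀ : AEMeasurable x₀ μ)
    {S : Finset P} {F : Type*} [MeasurableSpace F] [StandardBorelSpace F] [Nonempty F]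
    {Z : Ω → F} (hZ : Measurable[historySigma I x₀ S] Z) : AEMeasurable Z μ := by
  obtain ⟨h, hm, rfl⟩ := hZ.exists_eq_measurable_comp
  exact hm.comp_aemeasurable
    ((measurable_pi_lambda _ fun p : S => hI p).aemeasurable.prodMk hx₀)

lemma indepFun_history [IsProbabilityMeasure μ] (hI : ∀ p, Measurable (I p))
    (hx₀ : AEMeasurable x₀ μ) (hiI : iIndepFun I μ)
    (hindep : IndepFun (fun ω => fun p => I p ω) x₀ μ)
    {J : Type*} [Fintype J] (g : J → P) {S : Finset P} (hg : ∀ q, g q ∉ S) :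
    IndepFun (fun ω q => I (g q) ω) (history I x₀ S) μ := by
  classical
  have hdisj : Disjoint (Finset.univ.image g) S := by
    rw [Finset.disjoint_left]
    intro p hp
    obtain ⟨q, -, rfl⟩ := Finset.mem_image.1 hp
    exact hg q
  have h1 := hiI.indepFun_finset _ S hdisj hI
  have h2 : IndepFun (fun ω q => I (g q) ω) (fun ω (p : S) => I p ω) μ :=
    h1.comp (φ := fun u q => u ⟨g q, Finset.mem_image_of_mem g (Finset.mem_univ q)⟩)
      (measurable_pi_lambda _ fun q => measurable_pi_apply _) measurable_id
  refine indepFun_prodMk_right (measurable_pi_lambda _ fun q => hI _)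
    (measurable_pi_lambda _ fun p => hI _) hx₀ h2 ?_
  exact hindep.comp (φ := fun u => ((fun q => u (g q) : J → ℕ), (fun p => u p : S → ℕ)))
    ((measurable_pi_lambda _ fun q => measurable_pi_apply (g q)).prodMk
      (measurable_pi_lambda (fun (u : P → ℕ) (p : S) => u p) fun p =>
        measurable_pi_apply (p : P))) measurable_id

/-- A sample that is encoded injectively by indices outside `S` is independent of everything
determined by the history `S`. -/
lemma indepFun_of_encode [IsProbabilityMeasure μ] (hI : ∀ p, Measurable (I p))
    (hx₀ : AEMeasurable x₀ μ) (hiI : iIndepFun I μ)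
    (hindep : IndepFun (fun ω => fun p => I p ω) x₀ μ)
    {J C F : Type*} [Fintype J] (g : J → P) {S : Finset P} (hg : ∀ q, g q ∉ S)
    [MeasurableSpace C] [Nonempty C] {enc : C → J → ℕ} (henc : Function.Injective enc)
    {c : Ω → C} (hc : ∀ ω q, enc (c ω) q = I (g q) ω)
    [MeasurableSpace F] {Z : Ω → F} (hZ : Measurable[historySigma I x₀ S] Z) :
    IndepFun c Z μ := by
  have h1 := (indepFun_history hI hx₀ hiI hindep g hg).comp
    (Measurable.of_discrete (f := Function.invFun enc)) measurable_id
  have h2 : Function.invFun enc ∘ (fun ω q => I (g q) ω) = c := by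
    ext1 ω
    rw [Function.comp_apply, ← funext (hc ω)]
    exact Function.leftInverse_invFun henc (c ω)
  rw [h2, Function.id_comp] at h1
  exact indep_of_indep_of_le_right h1 hZ.comap_le

/-- The time at which an index is drawn. -/
def drawTime {K B : ℕ} : ℕ × (Fin K × Fin B ⊕ Unit) → ℕ
  | (s, Sum.inl q) => s * (K + 1) + q.1
  | (s, Sum.inr _) => s * (K + 1) + K

/-- The indices drawn before time `t`. -/
def drawnBefore (K B t : ℕ) : Finset (ℕ × (Fin K × Fin B ⊕ Unit)) :=
  (Finset.range t ×ˢ Finset.univ).filter fun p => drawTime p < t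

lemma mem_drawnBefore {K B t : ℕ} {p : ℕ × (Fin K × Fin B ⊕ Unit)} :
    p ∈ drawnBefore K B t ↔ drawTime p < t := by
  simp only [drawnBefore, Finset.mem_filter, Finset.mem_product, Finset.mem_range,
    Finset.mem_univ, and_true, and_iff_right_iff_imp]
  obtain ⟨s, q | u⟩ := p <;> simp only [drawTime] <;> intro h <;> nlinarith

lemma drawnBefore_mono (K B : ℕ) {t t' : ℕ} (h : t ≤ t') :
    drawnBefore K B t ⊆ drawnBefore K B t' := fun _ hp =>
  mem_drawnBefore.2 ((mem_drawnBefore.1 hp).trans_le h)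

/-- The values of the indices of one iteration, in the order used by `allIdx`. -/
def encodeSample {m n A : ℕ} (v : (Fin A → Fin m) × Fin n × Fin m) (q : Fin (A + 2)) : ℕ :=
  if h : (q : ℕ) < A then (v.1 ⟨q, h⟩ : ℕ) else if (q : ℕ) = A then (v.2.1 : ℕ) else (v.2.2 : ℕ)

lemma encodeSample_injective {m n A : ℕ} :
    Function.Injective (encodeSample : (Fin A → Fin m) × Fin n × Fin m → Fin (A + 2) → ℕ) := by
  rintro ⟨a, i, j⟩ ⟨a', i', j'⟩ h
  have h1 : a = a' := by
    ext l
    have := congrFun h ⟨l, by omega⟩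
    simpa [encodeSample] using this
  have h2 : i = i' := by
    ext
    have := congrFun h ⟨A, by omega⟩
    simpa [encodeSample] using this
  have h3 : j = j' := by
    ext
    have := congrFun h ⟨A + 1, by omega⟩
    simpa [encodeSample] using this
  rw [h1, h2, h3]

lemma measurable_allIdx {m n K A : ℕ} {a : ℕ → Fin K → Fin A → Ω → Fin m}
    {i : ℕ → Fin K → Ω → Fin n} {j : ℕ → Fin K → Ω → Fin m} {r : ℕ → Ω → Fin K}
    (ha : ∀ s k l, Measurable (a s k l)) (hi : ∀ s k, Measurable (i s k))
    (hj : ∀ s k, Measurable (j s k)) (hr : ∀ s, Measurable (r s))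
    (p : ℕ × (Fin K × Fin (A + 2) ⊕ Unit)) : Measurable (allIdx K A a i j r p) := by
  obtain ⟨s, ⟨k, q⟩ | u⟩ := p
  · by_cases h : (q : ℕ) < A
    · have : allIdx K A a i j r (s, Sum.inl (k, q)) = Fin.val ∘ a s k ⟨q, h⟩ := by
        ext; simp [allIdx, h]
      rw [this]
      exact Measurable.of_discrete.comp (ha s k _)
    · by_cases h' : (q : ℕ) = A
      · have : allIdx K A a i j r (s, Sum.inl (k, q)) = Fin.val ∘ i s k := by
          ext; simp [allIdx, h']
        rw [this]
        exact Measurable.of_discrete.comp (hi s k)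
      · have : allIdx K A a i j r (s, Sum.inl (k, q)) = Fin.val ∘ j s k := by
          ext; simp [allIdx, h, h']
        rw [this]
        exact Measurable.of_discrete.comp (hj s k)
  · exact (Measurable.of_discrete (f := (Fin.val : Fin K → ℕ))).comp (hr s)

lemma measureReal_sample {m n K A : ℕ} [IsProbabilityMeasure μ]
    {a : ℕ → Fin K → Fin A → Ω → Fin m}
    {i : ℕ → Fin K → Ω → Fin n} {j : ℕ → Fin K → Ω → Fin m} {r : ℕ → Ω → Fin K}
    (ha : ∀ s k l c, μ {ω | a s k l ω = c} = (m : ℝ≥0∞)⁻¹)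
    (hi : ∀ s k c, μ {ω | i s k ω = c} = (n : ℝ≥0∞)⁻¹)
    (hj : ∀ s k c, μ {ω | j s k ω = c} = (m : ℝ≥0∞)⁻¹)
    (hiI : iIndepFun (allIdx K A a i j r) μ) (s : ℕ) (k : Fin K)
    (v : (Fin A → Fin m) × Fin n × Fin m) :
    μ.real ((fun ω => ((fun l => a s k l ω, i s k ω, j s k ω) :
      (Fin A → Fin m) × Fin n × Fin m)) ⁻¹' {v}) = ((m : ℝ) ^ A * (n * m))⁻¹ := by
  set g : Fin (A + 2) → ℕ × (Fin K × Fin (A + 2) ⊕ Unit) := fun q => (s, Sum.inl (k, q)) with hg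
  have hginj : Function.Injective g := fun q q' h => by simpa [hg] using h
  have h1 := (hiI.precomp hginj).measure_inter_preimage_eq_mul Finset.univ
    (sets := fun q => {encodeSample v q}) (fun _ _ => measurableSet_singleton _)
  have hset : (fun ω => ((fun l => a s k l ω, i s k ω, j s k ω) :
      (Fin A → Fin m) × Fin n × Fin m)) ⁻¹' {v}
      = ⋂ q ∈ Finset.univ, allIdx K A a i j r (g q) ⁻¹' {encodeSample v q} := by
    ext ω
    simp only [Set.mem_preimage, Set.mem_singleton_iff, Finset.mem_univ, Set.iInter_true,
      Set.mem_iInter]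
    constructor
    · rintro rfl q
      rfl
    · intro h
      exact encodeSample_injective (funext h)
  rw [measureReal_def, hset, h1]
  have hleft : ∀ l : Fin A, μ (allIdx K A a i j r (g l.castSucc.castSucc) ⁻¹'
      {encodeSample v l.castSucc.castSucc}) = (m : ℝ≥0∞)⁻¹ := by
    intro l
    rw [← ha s k l (v.1 l)]
    congr 1
    ext ω
    simp [allIdx, hg, encodeSample, Fin.val_inj]
  have hmid : μ (allIdx K A a i j r (g (Fin.last A).castSucc) ⁻¹'
      {encodeSample v (Fin.last A).castSucc}) = (n : ℝ≥0∞)⁻¹ := by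
    rw [← hi s k v.2.1]
    congr 1
    ext ω
    simp [allIdx, hg, encodeSample, Fin.val_inj]
  have hright : μ (allIdx K A a i j r (g (Fin.last (A + 1))) ⁻¹'
      {encodeSample v (Fin.last (A + 1))}) = (m : ℝ≥0∞)⁻¹ := by
    rw [← hj s k v.2.2]
    congr 1
    ext ω
    simp [allIdx, hg, encodeSample, Fin.val_inj]
  rw [Fin.prod_univ_castSucc, Fin.prod_univ_castSucc]
  simp only [hleft, hmid, hright]
  simp [ENNReal.toReal_mul]
  ring

end Sampling

section Regularity

variable {N M m n A : ℕ}
  {Gc : Fin m → EuclideanSpace ℝ (Fin N) → EuclideanSpace ℝ (Fin M)}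
  {DG : Fin m → EuclideanSpace ℝ (Fin N) →
    (EuclideanSpace ℝ (Fin N) →L[ℝ] EuclideanSpace ℝ (Fin M))}
  {gF : Fin n → EuclideanSpace ℝ (Fin M) → EuclideanSpace ℝ (Fin M)}
  {BG LF Lf : ℝ} {xstar : EuclideanSpace ℝ (Fin N)}

lemma exists_norm_svrgDir_le (hm : 0 < m) (hA : 0 < A)
    (hDG : ∀ j x, HasFDerivAt (Gc j) (DG j x) x)
    (hBG : 0 < BG) (hBGb : ∀ j x, ‖DG j x‖ ≤ BG)
    (hLFb : ∀ i u v, ‖gF i u - gF i v‖ ≤ LF * ‖u - v‖)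
    (hLfb : ∀ (x y : EuclideanSpace ℝ (Fin N)) (i : Fin n) (j : Fin m),
      ‖ContinuousLinearMap.adjoint (DG j x) (gF i (Gbar Gc x))
        - ContinuousLinearMap.adjoint (DG j y) (gF i (Gbar Gc y))‖ ≤ Lf * ‖x - y‖)
    (hLip : ∀ x y, ‖gradf Gc DG gF x - gradf Gc DG gF y‖ ≤ Lf * ‖x - y‖)
    (hg : gradf Gc DG gF xstar = 0) :
    ∃ C : ℝ, ∀ (v : (Fin A → Fin m) × Fin n × Fin m) (x y : EuclideanSpace ℝ (Fin N)),
      ‖svrgDir Gc DG gF v x y‖ ≤ C * (‖x - y‖ + ‖y - xstar‖) := by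
  set c : ℝ := 3 * (BG ^ 2 * LF ^ 2 * ((m : ℝ) ^ A * (BG ^ 2 / A)) + Lf ^ 2) with hc
  have hc0 : 0 ≤ c := by positivity
  refine ⟨√c, fun v x y => ?_⟩
  refine (sq_le_sq₀ (norm_nonneg _) (by positivity)).1 ?_
  have h1 := norm_svrgDir_sq_le hBG hBGb hLFb hLfb hLip hg v x y
  have h2 := mul_le_mul_of_nonneg_left (norm_innerEst_sub_sq_le hm hA hDG hBGb v.1 x y)
    (by positivity : 0 ≤ BG ^ 2 * LF ^ 2)
  have h3 : ‖svrgDir Gc DG gF v x y‖ ^ 2 ≤ c * ‖x - y‖ ^ 2 + 3 * Lf ^ 2 * ‖y - xstar‖ ^ 2 := by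
    refine h1.trans ?_
    rw [hc]
    have : BG ^ 2 * LF ^ 2 * ((m : ℝ) ^ A * (BG ^ 2 * ‖x - y‖ ^ 2 / A))
      = BG ^ 2 * LF ^ 2 * ((m : ℝ) ^ A * (BG ^ 2 / A)) * ‖x - y‖ ^ 2 := by ring
    linarith
  have h4 : 3 * Lf ^ 2 ≤ c := by
    have : 0 ≤ BG ^ 2 * LF ^ 2 * ((m : ℝ) ^ A * (BG ^ 2 / A)) := by positivity
    rw [hc]; linarith
  rw [mul_pow, Real.sq_sqrt hc0]
  calc _ ≤ _ := h3
    _ ≤ c * ‖x - y‖ ^ 2 + c * ‖y - xstar‖ ^ 2 := by gcongr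
    _ ≤ c * (‖x - y‖ + ‖y - xstar‖) ^ 2 := by
      have : 0 ≤ c * (2 * ‖x - y‖ * ‖y - xstar‖) := by positivity
      linarith

lemma continuous_svrgDir (hGc : ∀ j, ContDiff ℝ 1 (Gc j))
    (hDG : ∀ j x, HasFDerivAt (Gc j) (DG j x) x)
    (hLFb : ∀ i u v, ‖gF i u - gF i v‖ ≤ LF * ‖u - v‖)
    (hLip : ∀ x y, ‖gradf Gc DG gF x - gradf Gc DG gF y‖ ≤ Lf * ‖x - y‖)
    (v : (Fin A → Fin m) × Fin n × Fin m) :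
    Continuous fun z : EuclideanSpace ℝ (Fin N) × EuclideanSpace ℝ (Fin N) =>
      svrgDir Gc DG gF v z.1 z.2 := by
  have hG : ∀ j, Continuous (Gc j) := fun j => (hGc j).continuous
  have hD : ∀ j, Continuous fun x => ContinuousLinearMap.adjoint (DG j x) := by
    intro j
    have : DG j = fderiv ℝ (Gc j) := funext fun x => (hDG j x).fderiv.symm
    rw [this]
    exact (LinearIsometryEquiv.continuous _).comp ((hGc j).continuous_fderiv one_ne_zero)
  have hF : ∀ i, Continuous (gF i) := fun i =>
    (LipschitzWith.of_dist_le' fun u w => by simpa [dist_eq_norm] using hLFb i u w).continuous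
  have hf : Continuous (gradf Gc DG gF) :=
    (LipschitzWith.of_dist_le' fun u w => by simpa [dist_eq_norm] using hLip u w).continuous
  have hGbar : Continuous (Gbar Gc) := by
    unfold Gbar
    fun_prop
  unfold svrgDir innerEst
  refine ((((hD _).comp continuous_fst).clm_apply ((hF _).comp ?_)).sub
    (((hD _).comp continuous_snd).clm_apply ((hF _).comp (hGbar.comp continuous_snd)))).add
    (hf.comp continuous_snd)
  fun_prop

end Regularity

/-- A direction of linear growth, evaluated at a random sample and square-integrable points, is
square-integrable. -/
lemma memLp_two_of_linear_growth {Ω V : Type*} [MeasurableSpace Ω] {μ : Measure Ω}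
    [IsFiniteMeasure μ] [MeasurableSpace V] [Countable V] [MeasurableSingletonClass V] {N : ℕ}
    {f : V → EuclideanSpace ℝ (Fin N) → EuclideanSpace ℝ (Fin N) → EuclideanSpace ℝ (Fin N)}
    (hf : ∀ v, Continuous fun z : EuclideanSpace ℝ (Fin N) × EuclideanSpace ℝ (Fin N) =>
      f v z.1 z.2)
    {C : ℝ} {x' : EuclideanSpace ℝ (Fin N)}
    (hC : ∀ v x y, ‖f v x y‖ ≤ C * (‖x - y‖ + ‖y - x'‖))
    {c : Ω → V} (hc : Measurable c) {x y : Ω → EuclideanSpace ℝ (Fin N)}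
    (hx : MemLp x 2 μ) (hy : MemLp y 2 μ) :
    MemLp (fun ω => f (c ω) (x ω) (y ω)) 2 μ := by
  have hmeas : AEMeasurable (fun ω => f (c ω) (x ω) (y ω)) μ :=
    aemeasurable_apply_of_countable (fun v => (hf v).measurable) hc
      (hx.1.aemeasurable.prodMk hy.1.aemeasurable)
  have hbound : MemLp (fun ω => ‖x ω - y ω‖ + ‖y ω - x'‖) 2 μ :=
    (hx.sub hy).norm.add (hy.sub (memLp_const x')).norm
  refine hbound.of_le_mul (c := C) hmeas.aestronglyMeasurable
    (Filter.Eventually.of_forall fun ω => ?_)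
  rw [Real.norm_of_nonneg (by positivity)]
  exact hC _ _ _

/-- Summing the one-step contraction over an epoch. -/
lemma epoch_average_le {e : ℕ → ℝ} {η : ℝ} {K : ℕ} (hη : 0 < η) (hKη : 16 ≤ K * η)
    (he0 : 0 ≤ e 0) (heK : 0 ≤ e K)
    (h : ∀ k < K, e (k + 1) ≤ (1 - η) * e k + η / 2 * e 0) :
    (K : ℝ)⁻¹ * ∑ k ∈ Finset.range K, e k ≤ 7 / 8 * e 0 := by
  have hK : (0 : ℝ) < K := by
    by_contra! hc
    nlinarith
  have h1 : ∑ k ∈ Finset.range K, (e (k + 1) - e k)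
      ≤ ∑ k ∈ Finset.range K, (η / 2 * e 0 - η * e k) :=
    Finset.sum_le_sum fun k hk => by linarith [h k (Finset.mem_range.1 hk)]
  rw [Finset.sum_range_sub, Finset.sum_sub_distrib, Finset.sum_const, Finset.card_range,
    nsmul_eq_mul, ← Finset.mul_sum] at h1
  have h2 : 16 * e 0 ≤ K * η * e 0 := mul_le_mul_of_nonneg_right hKη he0
  rw [inv_mul_le_iff₀ hK]
  refine le_of_mul_le_mul_left ?_ hη
  linarith

/-- Linear convergence of multi-epoch Compositional-SVRG-1. -/
theorem stmt10
    (N M m n : ℕ) (hN : 0 < N) (hM : 0 < M) (hm : 0 < m) (hn : 0 < n)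
    (Gc : Fin m → EuclideanSpace ℝ (Fin N) → EuclideanSpace ℝ (Fin M))
    (DG : Fin m → EuclideanSpace ℝ (Fin N) → (EuclideanSpace ℝ (Fin N) →L[ℝ] EuclideanSpace ℝ (Fin M)))
    (hGc : ∀ j, ContDiff ℝ 1 (Gc j))
    (hDG : ∀ (j : Fin m) (x : EuclideanSpace ℝ (Fin N)), HasFDerivAt (Gc j) (DG j x) x)
    (Fc : Fin n → EuclideanSpace ℝ (Fin M) → ℝ)
    (gF : Fin n → EuclideanSpace ℝ (Fin M) → EuclideanSpace ℝ (Fin M))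
    (hFc : ∀ i, ContDiff ℝ 1 (Fc i))
    (hgF : ∀ (i : Fin n) (y : EuclideanSpace ℝ (Fin M)), HasGradientAt (Fc i) (gF i y) y)
    (BG : ℝ) (hBG : 0 < BG)
    (hBGb : ∀ (j : Fin m) (x : EuclideanSpace ℝ (Fin N)), ‖DG j x‖ ≤ BG)
    (LF : ℝ) (hLF : 0 < LF)
    (hLFb : ∀ (i : Fin n) (u v : EuclideanSpace ℝ (Fin M)), ‖gF i u - gF i v‖ ≤ LF * ‖u - v‖)
    (Lf : ℝ) (hLf : 0 < Lf)
    (hLfb : ∀ (x y : EuclideanSpace ℝ (Fin N)) (i : Fin n) (j : Fin m),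
      ‖ContinuousLinearMap.adjoint (DG j x) (gF i (Gbar Gc x))
        - ContinuousLinearMap.adjoint (DG j y) (gF i (Gbar Gc y))‖ ≤ Lf * ‖x - y‖)
    (μf : ℝ) (hμf : 0 < μf)
    (hsc : ∀ x y : EuclideanSpace ℝ (Fin N),
      fObj Gc Fc y ≥ fObj Gc Fc x + ⟪gradf Gc DG gF x, y - x⟫ + μf / 2 * ‖y - x‖ ^ 2)
    (xstar : EuclideanSpace ℝ (Fin N)) (hxstar : ∀ x, fObj Gc Fc xstar ≤ fObj Gc Fc x)
    (Ω : Type*) [MeasurableSpace Ω] (μ : Measure Ω) [IsProbabilityMeasure μ]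
    (γ : ℝ) (hγpos : 0 < γ) (K : ℕ) (hK : 1 ≤ K) (A : ℕ) (hA : 1 ≤ A)
    (xt : ℕ → Ω → EuclideanSpace ℝ (Fin N)) (hxt0 : MemLp (xt 0) 2 μ)
    (a : ℕ → Fin K → Fin A → Ω → Fin m) (i : ℕ → Fin K → Ω → Fin n)
    (j : ℕ → Fin K → Ω → Fin m) (r : ℕ → Ω → Fin K)
    (ha_meas : ∀ s (k : Fin K) (l : Fin A), Measurable (a s k l))
    (hi_meas : ∀ s (k : Fin K), Measurable (i s k)) (hj_meas : ∀ s (k : Fin K), Measurable (j s k))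
    (hr_meas : ∀ s, Measurable (r s))
    (ha_unif : ∀ s (k : Fin K) (l : Fin A) (c : Fin m), μ {ω | a s k l ω = c} = (m : ℝ≥0∞)⁻¹)
    (hi_unif : ∀ s (k : Fin K) (c : Fin n), μ {ω | i s k ω = c} = (n : ℝ≥0∞)⁻¹)
    (hj_unif : ∀ s (k : Fin K) (c : Fin m), μ {ω | j s k ω = c} = (m : ℝ≥0∞)⁻¹)
    (hr_unif : ∀ s (c : Fin K), μ {ω | r s ω = c} = (K : ℝ≥0∞)⁻¹)
    (hidx_indep : iIndepFun
      (m := fun _ : ℕ × (Fin K × Fin (A + 2) ⊕ Unit) => (inferInstance : MeasurableSpace ℕ))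
      (allIdx K A a i j r) μ)
    (hindep : IndepFun (fun ω => fun p => allIdx K A a i j r p ω) (xt 0) μ)
    (X : ℕ → ℕ → Ω → EuclideanSpace ℝ (Fin N))
    (hX0 : ∀ s, X s 0 = xt s)
    (hrec : ∀ s k, ∀ hk : k < K, X s (k + 1) = fun ω =>
      X s k ω - γ • (ContinuousLinearMap.adjoint (DG (j s ⟨k, hk⟩ ω) (X s k ω)) (gF (i s ⟨k, hk⟩ ω)
            (Gbar Gc (xt s ω) - (A : ℝ)⁻¹ •
              ∑ l : Fin A, (Gc (a s ⟨k, hk⟩ l ω) (xt s ω) - Gc (a s ⟨k, hk⟩ l ω) (X s k ω))))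
          - ContinuousLinearMap.adjoint (DG (j s ⟨k, hk⟩ ω) (xt s ω))
              (gF (i s ⟨k, hk⟩ ω) (Gbar Gc (xt s ω)))
          + gradf Gc DG gF (xt s ω)))
    (hout : ∀ s : ℕ, xt (s + 1) = fun ω => X s ((r s ω : ℕ)) ω)
    (hγ : γ = μf / (32 * Lf ^ 2))
    (hAc : 512 * BG ^ 4 * LF ^ 2 / μf ^ 2 ≤ (A : ℝ))
    (hKc : 512 * Lf ^ 2 / μf ^ 2 ≤ (K : ℝ)) :
    ∀ S : ℕ,
      ∫ ω, ‖xt S ω - xstar‖ ^ 2 ∂μ ≤ (7 / 8 : ℝ) ^ S * ∫ ω, ‖xt 0 ω - xstar‖ ^ 2 ∂μ := by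
  have hLip := norm_gradf_sub_le hm hn hLfb
  have hg := gradf_eq_zero hLf hμf hLip hsc hxstar
  have hmono := mul_norm_sq_le_inner_gradf hg hsc
  have hμL := strongConvexity_le_lipschitz hN hg hLip hmono
  obtain ⟨C, hC⟩ := exists_norm_svrgDir_le (A := A) hm hA hDG hBG hBGb hLFb hLfb hLip hg
  have hcont := continuous_svrgDir (A := A) hGc hDG hLFb hLip
  have : Nonempty (Fin m) := ⟨⟨0, hm⟩⟩
  have : Nonempty (Fin n) := ⟨⟨0, hn⟩⟩
  have : Nonempty (Fin K) := ⟨⟨0, hK⟩⟩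
  set I := allIdx K A a i j r with hI_def
  have hI : ∀ p, Measurable (I p) := measurable_allIdx ha_meas hi_meas hj_meas hr_meas
  have hx₀ : AEMeasurable (xt 0) μ := hxt0.1.aemeasurable
  let c : ℕ → Fin K → Ω → (Fin A → Fin m) × Fin n × Fin m := fun s k ω =>
    (fun l => a s k l ω, i s k ω, j s k ω)
  have hc_enc : ∀ s k ω (q : Fin (A + 2)),
      encodeSample (c s k ω) q = I (s, Sum.inl (k, q)) ω := fun _ _ _ _ => rfl
  have hr_enc : ∀ s ω (u : Unit), (fun (v : Fin K) (_ : Unit) => (v : ℕ)) (r s ω) u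
      = I (s, Sum.inr u) ω := fun _ _ _ => rfl
  have hr_inj : Function.Injective fun (v : Fin K) (_ : Unit) => (v : ℕ) :=
    fun _ _ h => Fin.ext (congrFun h ())
  have hstep : ∀ s k (hk : k < K), X s (k + 1) = fun ω =>
      X s k ω - γ • svrgDir Gc DG gF (c s ⟨k, hk⟩ ω) (X s k ω) (xt s ω) := hrec
  have hXmeas : ∀ s,
      Measurable[historySigma I (xt 0) (drawnBefore K (A + 2) (s * (K + 1)))] (xt s) →
      ∀ k ≤ K, Measurable[historySigma I (xt 0) (drawnBefore K (A + 2) (s * (K + 1) + k))]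
        (X s k) := by
    intro s hs k
    induction k with
    | zero => intro _; rw [hX0]; exact hs
    | succ k ih =>
      intro hk
      have h1 : Measurable[historySigma I (xt 0) (drawnBefore K (A + 2) (s * (K + 1) + (k + 1)))]
          (X s k) := (ih (by omega)).mono
        (historySigma_mono (drawnBefore_mono K (A + 2) (by omega))) le_rfl
      have h2 : Measurable[historySigma I (xt 0) (drawnBefore K (A + 2) (s * (K + 1) + (k + 1)))]
          (xt s) := hs.mono (historySigma_mono (drawnBefore_mono K (A + 2) (by omega))) le_rfl
      have h3 : Measurable[historySigma I (xt 0) (drawnBefore K (A + 2) (s * (K + 1) + (k + 1)))]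
          (c s ⟨k, hk⟩) := measurable_of_encode (fun q => (s, Sum.inl (⟨k, hk⟩, q)))
        (fun q => mem_drawnBefore.2 (by simp only [drawTime]; omega)) encodeSample_injective
        (hc_enc s ⟨k, hk⟩)
      rw [hstep s k hk]
      exact @measurable_apply_of_countable _ _ _ (historySigma I (xt 0) _) _ _ _ _
        (fun v ω => X s k ω - γ • svrgDir Gc DG gF v (X s k ω) (xt s ω))
        (fun v => h1.sub (((hcont v).measurable.comp (h1.prodMk h2)).const_smul γ)) _ h3
  have hXmeas_le : ∀ s,
      Measurable[historySigma I (xt 0) (drawnBefore K (A + 2) (s * (K + 1)))] (xt s) →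
      ∀ k : Fin K, Measurable[historySigma I (xt 0) (drawnBefore K (A + 2) (s * (K + 1) + K))]
        (X s k) := fun s hs k => (hXmeas s hs k k.2.le).mono
    (historySigma_mono (drawnBefore_mono K (A + 2) (by omega))) le_rfl
  have hxt_meas : ∀ s,
      Measurable[historySigma I (xt 0) (drawnBefore K (A + 2) (s * (K + 1)))] (xt s) := by
    intro s
    induction s with
    | zero => exact measurable_init_history
    | succ s ih =>
      have h1 : ∀ k : Fin K, Measurable[historySigma I (xt 0)
          (drawnBefore K (A + 2) ((s + 1) * (K + 1)))] (X s k) := fun k =>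
        (hXmeas_le s ih k).mono
          (historySigma_mono (drawnBefore_mono K (A + 2) (by rw [add_mul]; omega))) le_rfl
      have h2 : Measurable[historySigma I (xt 0)
          (drawnBefore K (A + 2) ((s + 1) * (K + 1)))] (r s) :=
        measurable_of_encode (fun u => (s, Sum.inr u))
          (fun u => mem_drawnBefore.2 (by simp only [drawTime]; rw [add_mul]; omega)) hr_inj
          (hr_enc s)
      rw [hout s]
      exact @measurable_apply_of_countable _ _ _ (historySigma I (xt 0) _) _ _ _ _
        (fun k : Fin K => X s k) h1 _ h2
  replace hXmeas := fun s => hXmeas s (hxt_meas s)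
  replace hXmeas_le := fun s => hXmeas_le s (hxt_meas s)
  have hXae : ∀ s, ∀ k ≤ K, AEMeasurable (X s k) μ := fun s k hk =>
    aemeasurable_of_history hI hx₀ (hXmeas s k hk)
  have hxt_ae : ∀ s, AEMeasurable (xt s) μ := fun s =>
    aemeasurable_of_history hI hx₀ (hxt_meas s)
  have hc_meas : ∀ s k, Measurable (c s k) := fun s k =>
    (measurable_pi_lambda _ fun l => ha_meas s k l).prodMk ((hi_meas s k).prodMk (hj_meas s k))
  have hXLp : ∀ s, MemLp (xt s) 2 μ → ∀ k ≤ K, MemLp (X s k) 2 μ := by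
    intro s hs k
    induction k with
    | zero => intro _; rw [hX0]; exact hs
    | succ k ih =>
      intro hk
      have h1 := ih (by omega)
      rw [hstep s k hk]
      exact h1.sub ((memLp_two_of_linear_growth hcont hC (hc_meas s ⟨k, hk⟩) h1 hs).const_smul γ)
  have hxtLp : ∀ s, MemLp (xt s) 2 μ := by
    intro s
    induction s with
    | zero => exact hxt0
    | succ s ih =>
      have hbound : MemLp (fun ω => ∑ k : Fin K, ‖X s k ω‖) 2 μ :=
        memLp_finsetSum _ fun k _ => (hXLp s ih k k.2.le).norm
      refine hbound.mono (hxt_ae (s + 1)).aestronglyMeasurable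
        (Filter.Eventually.of_forall fun ω => ?_)
      rw [hout s, Real.norm_of_nonneg (by positivity)]
      exact Finset.single_le_sum (f := fun k : Fin K => ‖X s k ω‖)
        (fun _ _ => norm_nonneg _) (Finset.mem_univ (r s ω))
  replace hXLp := fun s => hXLp s (hxtLp s)
  have hint : ∀ {W : Ω → EuclideanSpace ℝ (Fin N)}, MemLp W 2 μ →
      Integrable (fun ω => ‖W ω - xstar‖ ^ 2) μ := fun hW =>
    (hW.sub (memLp_const xstar)).integrable_norm_pow two_ne_zero
  have hη : 0 < γ * μf := by positivity
  have hdesc : ∀ s, ∀ k < K, ∫ ω, ‖X s (k + 1) ω - xstar‖ ^ 2 ∂μ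
      ≤ (1 - γ * μf) * ∫ ω, ‖X s k ω - xstar‖ ^ 2 ∂μ
        + γ * μf / 2 * ∫ ω, ‖X s 0 ω - xstar‖ ^ 2 ∂μ := by
    intro s k hk
    have hY : Measurable[historySigma I (xt 0) (drawnBefore K (A + 2) (s * (K + 1) + k))] (xt s) :=
      (hxt_meas s).mono (historySigma_mono (drawnBefore_mono K (A + 2) (by omega))) le_rfl
    have hZ : Measurable[historySigma I (xt 0) (drawnBefore K (A + 2) (s * (K + 1) + k))]
        fun ω => (X s k ω, xt s ω) := (hXmeas s k hk.le).prodMk hY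
    have hind := indepFun_of_encode hI hx₀ hidx_indep hindep
      (fun q : Fin (A + 2) => (s, Sum.inl ((⟨k, hk⟩ : Fin K), q)))
      (fun q => by rw [mem_drawnBefore]; simp only [drawTime]; omega) encodeSample_injective
      (hc_enc s ⟨k, hk⟩) hZ
    have hintv : ∀ v : (Fin A → Fin m) × Fin n × Fin m, Integrable
        (fun ω => ‖X s k ω - γ • svrgDir Gc DG gF v (X s k ω) (xt s ω) - xstar‖ ^ 2) μ :=
      fun v => hint ((hXLp s k hk.le).sub
        ((memLp_two_of_linear_growth hcont hC (measurable_const (a := v)) (hXLp s k hk.le) (hxtLp s)).const_smul γ))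
    have havg := integral_uniform_apply (hc_meas s ⟨k, hk⟩)
      ((hXae s k hk.le).prodMk (hxt_ae s)) hind
      (measureReal_sample ha_unif hi_unif hj_unif hidx_indep s ⟨k, hk⟩)
      (φ := fun v z => ‖z.1 - γ • svrgDir Gc DG gF v z.1 z.2 - xstar‖ ^ 2)
      (fun v => (((continuous_fst.sub ((hcont v).const_smul γ)).sub
        continuous_const).norm.pow 2).measurable) hintv
    have hp : (0 : ℝ) < (m : ℝ) ^ A * (n * m) := by
      have : (0 : ℝ) < m := by exact_mod_cast hm
      have : (0 : ℝ) < n := by exact_mod_cast hn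
      positivity
    rw [hstep s k hk, havg, ← integral_finsetSum _ fun v _ => hintv v, inv_mul_le_iff₀ hp,
      hX0, ← integral_const_mul, ← integral_const_mul,
      ← integral_add ((hint (hXLp s k hk.le)).const_mul _) ((hint (hxtLp s)).const_mul _),
      ← integral_const_mul]
    refine integral_mono (integrable_finsetSum _ fun v _ => hintv v)
      ((((hint (hXLp s k hk.le)).const_mul _).add ((hint (hxtLp s)).const_mul _)).const_mul _)
      fun ω => ?_
    exact sum_norm_step_sub_sq_le hm hn hA hDG hBG hBGb hLF hLFb hLf hLfb hμf hμL hmono hg hγ hAc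
      (X s k ω) (xt s ω)
  have hepoch : ∀ s, ∫ ω, ‖xt (s + 1) ω - xstar‖ ^ 2 ∂μ
      ≤ 7 / 8 * ∫ ω, ‖xt s ω - xstar‖ ^ 2 ∂μ := by
    intro s
    have hZ : Measurable[historySigma I (xt 0) (drawnBefore K (A + 2) (s * (K + 1) + K))]
        fun ω (k : Fin K) => X s k ω :=
      @measurable_pi_lambda _ _ _ (historySigma I (xt 0) _) _ _ (hXmeas_le s)
    have hind := indepFun_of_encode hI hx₀ hidx_indep hindep
      (fun u : Unit => ((s, Sum.inr u) : ℕ × (Fin K × Fin (A + 2) ⊕ Unit)))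
      (fun u => by rw [mem_drawnBefore]; simp only [drawTime]; omega) hr_inj (hr_enc s) hZ
    have havg := integral_uniform_apply (hr_meas s)
      (aemeasurable_pi_lambda _ fun k : Fin K => hXae s k k.2.le) hind (p := (K : ℝ)⁻¹)
      (fun v => by
        have := hr_unif s v
        rw [measureReal_def]
        erw [this]
        simp)
      (φ := fun k z => ‖z k - xstar‖ ^ 2)
      (fun k => (((continuous_apply k).sub continuous_const).norm.pow 2).measurable)
      (fun k => hint (hXLp s k k.2.le))
    have hKη : 16 ≤ K * (γ * μf) := by
      rw [div_le_iff₀ (by positivity)] at hKc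
      rw [hγ, div_mul_eq_mul_div, mul_div_assoc', le_div_iff₀ (by positivity)]
      linarith
    have h1 := epoch_average_le (e := fun k => ∫ ω, ‖X s k ω - xstar‖ ^ 2 ∂μ) hη hKη
      (integral_nonneg fun _ => sq_nonneg _) (integral_nonneg fun _ => sq_nonneg _) (hdesc s)
    rw [Finset.sum_range] at h1
    simp only [hX0] at h1
    rw [hout s]
    exact havg.trans_le h1
  intro S
  induction S with
  | zero => simp
  | succ S ih =>
    calc _ ≤ _ := hepoch S
      _ ≤ 7 / 8 * ((7 / 8 : ℝ) ^ S * ∫ ω, ‖xt 0 ω - xstar‖ ^ 2 ∂μ) := by gcongr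
      _ = _ := by ring
end
end

section
/- (Lower bound on the inner product term T_1 for Compositional-SVRG-2, eq. (35)) The estimators of one step of Compositional-SVRG-2 satisfy E⟨(Ĝ')^⊤ ∇F_i(Ĝ), x − x*⟩ ≥ −(8 B_G² L_F²/μ_f) · E‖Ĝ − G(x)‖² + (3/4) · E(f(x) − f*). -/
open MeasureTheory ProbabilityTheory
open scoped BigOperators RealInnerProductSpace ENNReal

noncomputable section

/-- The combined family of random indices `a₁, …, a_A, b₁, …, b_B, i` used by one
step of Compositional-SVRG-2, embedded into `ℕ`. -/
def idx2 {Ω : Type*} {mN nN : ℕ} (A B : ℕ)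
    (a : Fin A → Ω → Fin mN) (b : Fin B → Ω → Fin mN) (i : Ω → Fin nN) :
    Fin (A + B + 1) → Ω → ℕ :=
  fun k ω =>
    if h : (k : ℕ) < A then (a ⟨(k : ℕ), h⟩ ω : ℕ)
    else if h2 : (k : ℕ) < A + B then (b ⟨(k : ℕ) - A, by omega⟩ ω : ℕ)
    else (i ω : ℕ)

/-- If `P` is independent of `Q` and the pair `(P, Q)` is independent of `Z`, then `P` is
independent of `(Q, Z)`. -/
lemma indepFun_prodMk_right_s15 {Ω α β γ : Type*} [MeasurableSpace Ω] [MeasurableSpace α]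
    [MeasurableSpace β] [MeasurableSpace γ] {μ : Measure Ω} [IsProbabilityMeasure μ]
    {P : Ω → α} {Q : Ω → β} {Z : Ω → γ} (hP : AEMeasurable P μ) (hQ : AEMeasurable Q μ)
    (hZ : AEMeasurable Z μ) (hPQ : IndepFun P Q μ) (h : IndepFun (fun ω => (P ω, Q ω)) Z μ) :
    IndepFun P (fun ω => (Q ω, Z ω)) μ := by
  have hQZ : IndepFun Q Z μ := h.comp measurable_snd measurable_id
  rw [indepFun_iff_map_prod_eq_prod_map_map hP (hQ.prodMk hZ),
    hQZ.map_prod_eq_prod_map_map hQ hZ, ← Measure.prodAssoc_prod,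
    ← hPQ.map_prod_eq_prod_map_map hP hQ,
    ← h.map_prod_eq_prod_map_map (hP.prodMk hQ) hZ,
    AEMeasurable.map_map_of_aemeasurable MeasurableEquiv.prodAssoc.measurable.aemeasurable
      ((hP.prodMk hQ).prodMk hZ)]
  rfl

/-- One member of an independent family which is jointly independent of `Z` is independent of the
remaining members together with `Z`. -/
lemma iIndepFun_indepFun_erase_prodMk {Ω ι β γ : Type*} [MeasurableSpace Ω] [Fintype ι]
    [DecidableEq ι] [MeasurableSpace β] [MeasurableSpace γ] {μ : Measure Ω}
    [IsProbabilityMeasure μ] {X : ι → Ω → β} {Z : Ω → γ} (hX : ∀ k, Measurable (X k))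
    (hZ : AEMeasurable Z μ) (hind : iIndepFun X μ) (hXZ : IndepFun (fun ω k => X k ω) Z μ)
    (k : ι) :
    IndepFun (X k) (fun ω => ((fun j : (Finset.univ.erase k : Finset ι) => X j ω), Z ω)) μ := by
  refine indepFun_prodMk_right_s15 (hX k).aemeasurable
    (measurable_pi_lambda _ fun j : (Finset.univ.erase k : Finset ι) => hX j).aemeasurable
    hZ ?_ ?_
  · have := hind.indepFun_finset {k} (Finset.univ.erase k) (by simp) hX
    exact this.comp (φ := fun v : ({k} : Finset ι) → β => v ⟨k, by simp⟩)
      (measurable_pi_apply _) measurable_id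
  · exact hXZ.comp (φ := fun v => (v k, fun j : (Finset.univ.erase k : Finset ι) => v j))
      (by fun_prop) measurable_id

/-- Integrating out a uniform index that is independent of the remaining randomness. -/
lemma integral_uniform_index {Ω γ : Type*} [MeasurableSpace Ω] [MeasurableSpace γ]
    {μ : Measure Ω} [IsProbabilityMeasure μ] {k : ℕ} {J : Ω → Fin k} {Z : Ω → γ}
    (hJ : Measurable J) (hunif : ∀ c, μ {ω | J ω = c} = (k : ℝ≥0∞)⁻¹) (hJZ : IndepFun J Z μ)
    {h : Fin k → γ → ℝ} (hmeas : ∀ c, Measurable (h c))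
    (hint : ∀ c, Integrable (fun ω => h c (Z ω)) μ) :
    ∫ ω, h (J ω) (Z ω) ∂μ = ∫ ω, (k : ℝ)⁻¹ * ∑ c, h c (Z ω) ∂μ := by
  have hset (c : Fin k) : MeasurableSet {ω | J ω = c} := hJ (measurableSet_singleton c)
  have hsum (ω : Ω) : h (J ω) (Z ω)
      = ∑ c, ({ω | J ω = c}.indicator (fun _ => (1 : ℝ)) ω) * h c (Z ω) := by
    rw [Finset.sum_eq_single (J ω)]
    · simp
    · intro c _ hc
      simp [Set.indicator, hc.symm]
    · simp
  have hterm (c : Fin k) :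
      ∫ ω, ({ω | J ω = c}.indicator (fun _ => (1 : ℝ)) ω) * h c (Z ω) ∂μ
        = (k : ℝ)⁻¹ * ∫ ω, h c (Z ω) ∂μ := by
    have hI : IndepFun ({ω | J ω = c}.indicator (fun _ => (1 : ℝ))) (fun ω => h c (Z ω)) μ :=
      hJZ.comp (φ := ({c} : Set (Fin k)).indicator fun _ => (1 : ℝ)) (measurable_of_countable _)
        (hmeas c)
    rw [hI.integral_fun_mul_eq_mul_integral
      (measurable_const.indicator (hset c)).aestronglyMeasurable (hint c).1]
    congr 1
    rw [integral_indicator (hset c)]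
    simp [Measure.real, hunif c]
  simp_rw [hsum]
  rw [integral_finsetSum, integral_const_mul, integral_finsetSum _ fun c _ => hint c,
    Finset.mul_sum]
  · exact Finset.sum_congr rfl fun c _ => hterm c
  · intro c _
    refine ((hint c).indicator (hset c)).congr (ae_of_all _ fun ω => ?_)
    by_cases hc : J ω = c <;> simp [Set.indicator, hc]

/-- Selecting among finitely many `L^p` functions by a measurable index gives an `L^p` function. -/
lemma memLp_index {Ω E : Type*} [MeasurableSpace Ω] [NormedAddCommGroup E] {μ : Measure Ω}
    {p : ℝ≥0∞} {k : ℕ} {J : Ω → Fin k} (hJ : Measurable J) {h : Fin k → Ω → E}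
    (hh : ∀ c, MemLp (h c) p μ) : MemLp (fun ω => h (J ω) ω) p μ := by
  have hsum : (fun ω => h (J ω) ω) = fun ω => ∑ c, {ω | J ω = c}.indicator (h c) ω := by
    funext ω
    rw [Finset.sum_eq_single (J ω)]
    · simp
    · intro c _ hc
      simp [Set.indicator, hc.symm]
    · simp
  rw [hsum]
  exact memLp_finsetSum _ fun c _ => (hh c).indicator (hJ (measurableSet_singleton c))

lemma MemLp.integrable_inner_of_two {Ω E : Type*} [MeasurableSpace Ω] [NormedAddCommGroup E]
    [InnerProductSpace ℝ E] {μ : Measure Ω} {u v : Ω → E} (hu : MemLp u 2 μ) (hv : MemLp v 2 μ) :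
    Integrable (fun ω => ⟪u ω, v ω⟫) μ :=
  (hu.norm.integrable_mul hv.norm).mono' (hu.1.inner hv.1)
    (ae_of_all _ fun _ => norm_inner_le_norm _ _)

lemma continuous_of_norm_sub_le {E F : Type*} [SeminormedAddCommGroup E]
    [SeminormedAddCommGroup F] {g : E → F} {L : ℝ} (hg : ∀ u v, ‖g u - g v‖ ≤ L * ‖u - v‖) :
    Continuous g :=
  (LipschitzWith.of_dist_le' fun u v => by simpa only [dist_eq_norm] using hg u v).continuous

/-- A Lipschitz map sends `L^p` functions to `L^p` functions. -/
lemma memLp_comp_of_norm_sub_le {Ω E F : Type*} [MeasurableSpace Ω] [NormedAddCommGroup E]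
    [NormedAddCommGroup F] {μ : Measure Ω} [IsFiniteMeasure μ] {p : ℝ≥0∞} {g : E → F} {L : ℝ}
    (hg : ∀ u v, ‖g u - g v‖ ≤ L * ‖u - v‖) {X : Ω → E} (hX : MemLp X p μ) :
    MemLp (fun ω => g (X ω)) p μ := by
  have h0 : MemLp (fun ω => g (X ω) - g 0) p μ :=
    hX.of_le_mul (c := L)
      (((continuous_of_norm_sub_le hg).comp_aestronglyMeasurable hX.1).sub aestronglyMeasurable_const)
      (ae_of_all _ fun ω => by simpa using hg (X ω) 0)
  simpa [Pi.add_def] using h0.add (memLp_const (g 0))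

lemma memLp_clm_apply {Ω X E F : Type*} [MeasurableSpace Ω] [TopologicalSpace X]
    [NormedAddCommGroup E] [NormedSpace ℝ E] [NormedAddCommGroup F] [NormedSpace ℝ F]
    {μ : Measure Ω} {p : ℝ≥0∞} {T : X → E →L[ℝ] F} {C : ℝ} (hT : Continuous T)
    (hC : ∀ y, ‖T y‖ ≤ C) {y : Ω → X} (hy : AEStronglyMeasurable y μ) {w : Ω → E}
    (hw : MemLp w p μ) : MemLp (fun ω => T (y ω) (w ω)) p μ :=
  hw.of_le_mul (c := C)
    ((isBoundedBilinearMap_apply (𝕜 := ℝ) (E := E) (F := F)).continuous.comp_aestronglyMeasurable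
      ((hT.comp_aestronglyMeasurable hy).prodMk hw.1))
    (ae_of_all _ fun ω => (T (y ω)).le_of_opNorm_le (hC _) _)

lemma norm_inv_card_smul_sum_le {E : Type*} [SeminormedAddCommGroup E] [NormedSpace ℝ E] {k : ℕ}
    (hk : 0 < k) {v : Fin k → E} {C : ℝ} (hv : ∀ c, ‖v c‖ ≤ C) :
    ‖(k : ℝ)⁻¹ • ∑ c, v c‖ ≤ C := by
  have hk' : (0 : ℝ) < k := by exact_mod_cast hk
  rw [norm_smul, norm_inv, Real.norm_natCast, inv_mul_le_iff₀ hk']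
  simpa using norm_sum_le_of_le Finset.univ fun c _ => hv c

section Indices

variable {Ω : Type*} {mN nN A B : ℕ} {a : Fin A → Ω → Fin mN} {b : Fin B → Ω → Fin mN}
  {i : Ω → Fin nN}

lemma idx2_left (l : Fin A) (h : (l : ℕ) < A + B + 1) (ω : Ω) :
    idx2 A B a b i ⟨l, h⟩ ω = a l ω := by
  simp [idx2]

lemma idx2_right (l : Fin B) (h : A + (l : ℕ) < A + B + 1) (ω : Ω) :
    idx2 A B a b i ⟨A + l, h⟩ ω = b l ω := by
  simp [idx2]

lemma idx2_last (h : A + B < A + B + 1) (ω : Ω) : idx2 A B a b i ⟨A + B, h⟩ ω = i ω := by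
  simp [idx2]

variable [MeasurableSpace Ω]

lemma measurable_idx2 (ha : ∀ l, Measurable (a l)) (hb : ∀ l, Measurable (b l))
    (hi : Measurable i) (k : Fin (A + B + 1)) : Measurable (idx2 A B a b i k) := by
  unfold idx2
  split_ifs
  · exact (measurable_of_countable Fin.val).comp (ha _)
  · exact (measurable_of_countable Fin.val).comp (hb _)
  · exact (measurable_of_countable Fin.val).comp hi

variable {μ : Measure Ω} [IsProbabilityMeasure μ] {γ : Type*} [MeasurableSpace γ] {Z : Ω → γ}

lemma indepFun_last_index (hm : 0 < mN) (hn : 0 < nN) (ha : ∀ l, Measurable (a l))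
    (hb : ∀ l, Measurable (b l)) (hi : Measurable i) (hZ : AEMeasurable Z μ)
    (hind : iIndepFun (idx2 A B a b i) μ)
    (hidx : IndepFun (fun ω k => idx2 A B a b i k ω) Z μ) :
    IndepFun i (fun ω => (((fun l => a l ω), fun l => b l ω), Z ω)) μ := by
  have : NeZero mN := ⟨hm.ne'⟩
  have : NeZero nN := ⟨hn.ne'⟩
  have hleft (l' : Fin A) : (⟨l', by omega⟩ : Fin (A + B + 1)) ∈
      Finset.univ.erase ⟨A + B, by omega⟩ := by
    simp [Fin.ext_iff]
    omega
  have hright (l' : Fin B) : (⟨A + l', by omega⟩ : Fin (A + B + 1)) ∈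
      Finset.univ.erase ⟨A + B, by omega⟩ := by
    simp [Fin.ext_iff]
    omega
  have hofNat : Measurable (Fin.ofNat mN) := measurable_of_countable _
  have key := iIndepFun_indepFun_erase_prodMk (measurable_idx2 ha hb hi) hZ hind hidx
    ⟨A + B, by omega⟩
  have := key.comp (φ := Fin.ofNat nN)
    (ψ := fun q => (((fun l => Fin.ofNat mN (q.1 ⟨_, hleft l⟩)),
      fun l => Fin.ofNat mN (q.1 ⟨_, hright l⟩)), q.2))
    (measurable_of_countable _) (by fun_prop)
  simpa [Function.comp_def, idx2_left, idx2_right, idx2_last] using this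

lemma indepFun_right_index (hm : 0 < mN) (ha : ∀ l, Measurable (a l))
    (hb : ∀ l, Measurable (b l)) (hi : Measurable i) (hZ : AEMeasurable Z μ)
    (hind : iIndepFun (idx2 A B a b i) μ)
    (hidx : IndepFun (fun ω k => idx2 A B a b i k ω) Z μ) (l : Fin B) :
    IndepFun (b l) (fun ω => ((fun l => a l ω), Z ω)) μ := by
  have : NeZero mN := ⟨hm.ne'⟩
  have hleft (l' : Fin A) : (⟨l', by omega⟩ : Fin (A + B + 1)) ∈
      Finset.univ.erase ⟨A + l, by omega⟩ := by
    simp [Fin.ext_iff]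
    omega
  have hofNat : Measurable (Fin.ofNat mN) := measurable_of_countable _
  have key := iIndepFun_indepFun_erase_prodMk (measurable_idx2 ha hb hi) hZ hind hidx
    ⟨A + l, by omega⟩
  have := key.comp (φ := Fin.ofNat mN)
    (ψ := fun q => ((fun l' => Fin.ofNat mN (q.1 ⟨_, hleft l'⟩)), q.2))
    (measurable_of_countable _) (by fun_prop)
  simpa [Function.comp_def, idx2_left, idx2_right] using this

end Indices

lemma norm_average_sub_le {E F : Type*} [SeminormedAddCommGroup E] [SeminormedAddCommGroup F]
    [NormedSpace ℝ F] {k : ℕ} (hk : 0 < k) {g : Fin k → E → F} {L : ℝ}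
    (hg : ∀ c u v, ‖g c u - g c v‖ ≤ L * ‖u - v‖) (u v : E) :
    ‖(k : ℝ)⁻¹ • ∑ c, g c u - (k : ℝ)⁻¹ • ∑ c, g c v‖ ≤ L * ‖u - v‖ := by
  rw [← smul_sub, ← Finset.sum_sub_distrib]
  exact norm_inv_card_smul_sum_le hk fun c => hg c u v

/-- The weighted Young inequality used to absorb the estimation error of the inner function. -/
lemma neg_young_le {p q c μf : ℝ} (hμf : 0 < μf) :
    -(8 * c ^ 2 / μf) * p ^ 2 - μf / 32 * q ^ 2 ≤ -(c * p * q) := by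
  have h : 0 ≤ (16 * c * p - μf * q) ^ 2 / (32 * μf) := by positivity
  have e : (16 * c * p - μf * q) ^ 2 / (32 * μf)
      = 8 * c ^ 2 / μf * p ^ 2 + μf / 32 * q ^ 2 - c * p * q := by
    field_simp
    ring
  linarith

/-- Eq. (35): lower bound on the inner product term `T₁` for Compositional-SVRG-2. -/
theorem stmt15
    (N M m n : ℕ) (hN : 0 < N) (hM : 0 < M) (hm : 0 < m) (hn : 0 < n)
    (Gc : Fin m → EuclideanSpace ℝ (Fin N) → EuclideanSpace ℝ (Fin M))
    (DG : Fin m → EuclideanSpace ℝ (Fin N) → (EuclideanSpace ℝ (Fin N) →L[ℝ] EuclideanSpace ℝ (Fin M)))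
    (hGc : ∀ j, ContDiff ℝ 1 (Gc j))
    (hDG : ∀ (j : Fin m) (x : EuclideanSpace ℝ (Fin N)), HasFDerivAt (Gc j) (DG j x) x)
    (Fc : Fin n → EuclideanSpace ℝ (Fin M) → ℝ)
    (gF : Fin n → EuclideanSpace ℝ (Fin M) → EuclideanSpace ℝ (Fin M))
    (hFc : ∀ i, ContDiff ℝ 1 (Fc i))
    (hgF : ∀ (i : Fin n) (y : EuclideanSpace ℝ (Fin M)), HasGradientAt (Fc i) (gF i y) y)
    (BG : ℝ) (hBG : 0 < BG)
    (hBGb : ∀ (j : Fin m) (x : EuclideanSpace ℝ (Fin N)), ‖DG j x‖ ≤ BG)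
    (LF : ℝ) (hLF : 0 < LF)
    (hLFb : ∀ (i : Fin n) (u v : EuclideanSpace ℝ (Fin M)), ‖gF i u - gF i v‖ ≤ LF * ‖u - v‖)
    (μf : ℝ) (hμf : 0 < μf)
    (hsc : ∀ x y : EuclideanSpace ℝ (Fin N),
      fObj Gc Fc y ≥ fObj Gc Fc x + ⟪gradf Gc DG gF x, y - x⟫ + μf / 2 * ‖y - x‖ ^ 2)
    (xstar : EuclideanSpace ℝ (Fin N)) (hxstar : ∀ x, fObj Gc Fc xstar ≤ fObj Gc Fc x)
    (Ω : Type*) [MeasurableSpace Ω] (μ : Measure Ω) [IsProbabilityMeasure μ]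
    (A B : ℕ) (hA : 1 ≤ A) (hB : 1 ≤ B)
    (xt x : Ω → EuclideanSpace ℝ (Fin N))
    (hxt : MemLp xt 2 μ) (hx : MemLp x 2 μ)
    (a : Fin A → Ω → Fin m) (b : Fin B → Ω → Fin m) (i : Ω → Fin n)
    (ha_meas : ∀ l, Measurable (a l)) (hb_meas : ∀ l, Measurable (b l)) (hi_meas : Measurable i)
    (ha_unif : ∀ (l : Fin A) (c : Fin m), μ {ω | a l ω = c} = (m : ℝ≥0∞)⁻¹)
    (hb_unif : ∀ (l : Fin B) (c : Fin m), μ {ω | b l ω = c} = (m : ℝ≥0∞)⁻¹)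
    (hi_unif : ∀ c : Fin n, μ {ω | i ω = c} = (n : ℝ≥0∞)⁻¹)
    (hidx_indep : iIndepFun (m := fun _ : Fin (A + B + 1) => (inferInstance : MeasurableSpace ℕ))
      (idx2 A B a b i) μ)
    (hindep : IndepFun (fun ω => fun k => idx2 A B a b i k ω) (fun ω => (xt ω, x ω)) μ)
 :
    ∫ ω, (⟪ContinuousLinearMap.adjoint (DGbar DG (xt ω) - (B : ℝ)⁻¹ • ∑ l : Fin B, (DG (b l ω) (xt ω) - DG (b l ω) (x ω)))
            (gF (i ω) (Gbar Gc (xt ω) - (A : ℝ)⁻¹ • ∑ l : Fin A, (Gc (a l ω) (xt ω) - Gc (a l ω) (x ω)))), x ω - xstar⟫) ∂μ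
      ≥ (-(8 * BG ^ 2 * LF ^ 2 / μf)) * ∫ ω, ‖(Gbar Gc (xt ω) - (A : ℝ)⁻¹ • ∑ l : Fin A, (Gc (a l ω) (xt ω) - Gc (a l ω) (x ω))) - Gbar Gc (x ω)‖ ^ 2 ∂μ
        + 3 / 4 * ∫ ω, (fObj Gc Fc (x ω) - fObj Gc Fc xstar) ∂μ := by
  have hGlip (j : Fin m) (u v : EuclideanSpace ℝ (Fin N)) :
      ‖Gc j u - Gc j v‖ ≤ BG * ‖u - v‖ :=
    convex_univ.norm_image_sub_le_of_norm_hasFDerivWithin_le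
      (fun y _ => (hDG j y).hasFDerivWithinAt) (fun y _ => hBGb j y) trivial trivial
  have hDGc (j : Fin m) : Continuous (DG j) := by
    have : DG j = fderiv ℝ (Gc j) := funext fun y => (hDG j y).fderiv.symm
    rw [this]
    exact (hGc j).continuous_fderiv one_ne_zero
  have hGcc (j : Fin m) : Continuous (Gc j) := (hGc j).continuous
  have hgFc (d : Fin n) : Continuous (gF d) := continuous_of_norm_sub_le (hLFb d)
  have hGbarlip (u v : EuclideanSpace ℝ (Fin N)) : ‖Gbar Gc u - Gbar Gc v‖ ≤ BG * ‖u - v‖ :=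
    norm_average_sub_le hm hGlip u v
  have hgradFlip (u v : EuclideanSpace ℝ (Fin M)) :
      ‖gradFbar gF u - gradFbar gF v‖ ≤ LF * ‖u - v‖ :=
    norm_average_sub_le hn hLFb u v
  have hGbarc : Continuous (Gbar Gc) := continuous_of_norm_sub_le hGbarlip
  have hgradFc : Continuous (gradFbar gF) := continuous_of_norm_sub_le hgradFlip
  have hDGbarc : Continuous (DGbar DG) := by
    unfold DGbar
    fun_prop
  have hDGbarb (y : EuclideanSpace ℝ (Fin N)) : ‖DGbar DG y‖ ≤ BG :=
    norm_inv_card_smul_sum_le hm fun j => hBGb j y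
  set w : Ω → EuclideanSpace ℝ (Fin N) := fun ω => x ω - xstar
  set V : Ω → EuclideanSpace ℝ (Fin M) := fun ω =>
    Gbar Gc (xt ω) - (A : ℝ)⁻¹ • ∑ l : Fin A, (Gc (a l ω) (xt ω) - Gc (a l ω) (x ω))
  have hw : MemLp w 2 μ := hx.sub (memLp_const xstar)
  have hdiffG (c : Fin m) : MemLp (fun ω => Gc c (xt ω) - Gc c (x ω)) 2 μ :=
    (memLp_comp_of_norm_sub_le (hGlip c) hxt).sub (memLp_comp_of_norm_sub_le (hGlip c) hx)
  have hdiffa (l : Fin A) : MemLp (fun ω => Gc (a l ω) (xt ω) - Gc (a l ω) (x ω)) 2 μ :=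
    memLp_index (h := fun c ω => Gc c (xt ω) - Gc c (x ω)) (ha_meas l) hdiffG
  have hV : MemLp V 2 μ :=
    (memLp_comp_of_norm_sub_le hGbarlip hxt).sub
      ((memLp_finsetSum Finset.univ fun l _ => hdiffa l).const_smul (A : ℝ)⁻¹)
  have hGx : MemLp (fun ω => Gbar Gc (x ω)) 2 μ := memLp_comp_of_norm_sub_le hGbarlip hx
  have hU : MemLp (fun ω => gradFbar gF (V ω)) 2 μ := memLp_comp_of_norm_sub_le hgradFlip hV
  have hUx : MemLp (fun ω => gradFbar gF (Gbar Gc (x ω))) 2 μ :=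
    memLp_comp_of_norm_sub_le hgradFlip hGx
  have hSt : MemLp (fun ω => DGbar DG (xt ω) (w ω)) 2 μ :=
    memLp_clm_apply hDGbarc hDGbarb hxt.1 hw
  have hSx : MemLp (fun ω => DGbar DG (x ω) (w ω)) 2 μ :=
    memLp_clm_apply hDGbarc hDGbarb hx.1 hw
  have hdiff (c : Fin m) : MemLp (fun ω => DG c (xt ω) (w ω) - DG c (x ω) (w ω)) 2 μ :=
    (memLp_clm_apply (hDGc c) (hBGb c) hxt.1 hw).sub (memLp_clm_apply (hDGc c) (hBGb c) hx.1 hw)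
  have hdiffb (l : Fin B) :
      MemLp (fun ω => DG (b l ω) (xt ω) (w ω) - DG (b l ω) (x ω) (w ω)) 2 μ :=
    memLp_index (h := fun c ω => DG c (xt ω) (w ω) - DG c (x ω) (w ω)) (hb_meas l) hdiff
  have hD : MemLp (fun ω => DGbar DG (xt ω) (w ω) - (B : ℝ)⁻¹ • ∑ l : Fin B,
      (DG (b l ω) (xt ω) (w ω) - DG (b l ω) (x ω) (w ω))) 2 μ :=
    hSt.sub ((memLp_finsetSum Finset.univ fun l _ => hdiffb l).const_smul (B : ℝ)⁻¹)
  have hZ : AEMeasurable (fun ω => (xt ω, x ω)) μ := hxt.1.aemeasurable.prodMk hx.1.aemeasurable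
  have hmean_i :
      ∫ ω, ⟪gF (i ω) (V ω), DGbar DG (xt ω) (w ω) - (B : ℝ)⁻¹ • ∑ l : Fin B,
          (DG (b l ω) (xt ω) (w ω) - DG (b l ω) (x ω) (w ω))⟫ ∂μ
        = ∫ ω, ⟪gradFbar gF (V ω), DGbar DG (xt ω) (w ω) - (B : ℝ)⁻¹ • ∑ l : Fin B,
          (DG (b l ω) (xt ω) (w ω) - DG (b l ω) (x ω) (w ω))⟫ ∂μ := by
    have key := integral_uniform_index hi_meas hi_unif
      (indepFun_last_index hm hn ha_meas hb_meas hi_meas hZ hidx_indep hindep)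
      (h := fun d z => ⟪gF d (Gbar Gc z.2.1 - (A : ℝ)⁻¹ • ∑ l : Fin A,
          (Gc (z.1.1 l) z.2.1 - Gc (z.1.1 l) z.2.2)),
        DGbar DG z.2.1 (z.2.2 - xstar) - (B : ℝ)⁻¹ • ∑ l : Fin B,
          (DG (z.1.2 l) z.2.1 (z.2.2 - xstar) - DG (z.1.2 l) z.2.2 (z.2.2 - xstar))⟫)
      (fun d => measurable_from_prod_countable_right fun v =>
        Continuous.measurable (by dsimp only; fun_prop))
      (fun d => MemLp.integrable_inner_of_two (memLp_comp_of_norm_sub_le (hLFb d) hV) hD)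
    refine key.trans (integral_congr_ae (ae_of_all _ fun ω => ?_))
    simp only [gradFbar, real_inner_smul_left, sum_inner, V, w]
  have hmean_b (l : Fin B) :
      ∫ ω, ⟪gradFbar gF (V ω), DG (b l ω) (xt ω) (w ω) - DG (b l ω) (x ω) (w ω)⟫ ∂μ
        = ∫ ω, ⟪gradFbar gF (V ω), DGbar DG (xt ω) (w ω) - DGbar DG (x ω) (w ω)⟫ ∂μ := by
    have key := integral_uniform_index (hb_meas l) (hb_unif l)
      (indepFun_right_index hm ha_meas hb_meas hi_meas hZ hidx_indep hindep l)
      (h := fun c z => ⟪gradFbar gF (Gbar Gc z.2.1 - (A : ℝ)⁻¹ • ∑ l : Fin A,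
          (Gc (z.1 l) z.2.1 - Gc (z.1 l) z.2.2)),
        DG c z.2.1 (z.2.2 - xstar) - DG c z.2.2 (z.2.2 - xstar)⟫)
      (fun c => measurable_from_prod_countable_right fun v =>
        Continuous.measurable (by dsimp only; fun_prop))
      (fun c => MemLp.integrable_inner_of_two hU (hdiff c))
    refine key.trans (integral_congr_ae (ae_of_all _ fun ω => ?_))
    simp only [DGbar, smul_apply, sum_apply, ← smul_sub,
      ← Finset.sum_sub_distrib, real_inner_smul_right, inner_sum, V, w]
  have hBne : (B : ℝ) ≠ 0 := by positivity
  have hmean :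
      ∫ ω, ⟪gradFbar gF (V ω), DGbar DG (xt ω) (w ω) - (B : ℝ)⁻¹ • ∑ l : Fin B,
          (DG (b l ω) (xt ω) (w ω) - DG (b l ω) (x ω) (w ω))⟫ ∂μ
        = ∫ ω, ⟪gradFbar gF (V ω), DGbar DG (x ω) (w ω)⟫ ∂μ := by
    have hb_int (l : Fin B) := MemLp.integrable_inner_of_two hU (hdiffb l)
    have ht_int := MemLp.integrable_inner_of_two hU hSt
    have hx_int := MemLp.integrable_inner_of_two hU hSx
    simp_rw [inner_sub_right (𝕜 := ℝ) (gradFbar gF (V _)) (DGbar DG (xt _) (w _)),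
      real_inner_smul_right, inner_sum]
    rw [integral_sub ht_int ((integrable_finsetSum _ fun l _ => hb_int l).const_mul _),
      integral_const_mul, integral_finsetSum _ fun l _ => hb_int l]
    simp_rw [hmean_b, inner_sub_right]
    rw [integral_sub ht_int hx_int]
    simp only [Finset.sum_const, Finset.card_univ, Fintype.card_fin, nsmul_eq_mul]
    field_simp
    ring
  have hinner (ω : Ω) :
      ⟪ContinuousLinearMap.adjoint (DGbar DG (xt ω) - (B : ℝ)⁻¹ • ∑ l : Fin B,
          (DG (b l ω) (xt ω) - DG (b l ω) (x ω))) (gF (i ω) (V ω)), w ω⟫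
        = ⟪gF (i ω) (V ω), DGbar DG (xt ω) (w ω) - (B : ℝ)⁻¹ • ∑ l : Fin B,
          (DG (b l ω) (xt ω) (w ω) - DG (b l ω) (x ω) (w ω))⟫ := by
    rw [ContinuousLinearMap.adjoint_inner_left]
    simp
  have hconv (ω : Ω) : fObj Gc Fc (x ω) - fObj Gc Fc xstar + μf / 2 * ‖w ω‖ ^ 2
      ≤ ⟪gradFbar gF (Gbar Gc (x ω)), DGbar DG (x ω) (w ω)⟫ := by
    have h := hsc (x ω) xstar
    rw [gradf, ContinuousLinearMap.adjoint_inner_left, ← neg_sub, map_neg, inner_neg_right,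
      norm_neg] at h
    linarith
  have hf_int : Integrable (fun ω => fObj Gc Fc (x ω) - fObj Gc Fc xstar) μ := by
    have hfc : Continuous (fObj Gc Fc) := by
      have hFcc (d : Fin n) : Continuous (Fc d) := (hFc d).continuous
      unfold fObj
      fun_prop
    refine (MemLp.integrable_inner_of_two hUx hSx).mono'
      ((hfc.comp_aestronglyMeasurable hx.1).sub aestronglyMeasurable_const)
      (ae_of_all _ fun ω => ?_)
    rw [Real.norm_of_nonneg (sub_nonneg.2 (hxstar _))]
    have : 0 ≤ μf / 2 * ‖w ω‖ ^ 2 := by positivity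
    linarith [hconv ω]
  have hpoint (ω : Ω) : -(8 * BG ^ 2 * LF ^ 2 / μf) * ‖V ω - Gbar Gc (x ω)‖ ^ 2
      + 3 / 4 * (fObj Gc Fc (x ω) - fObj Gc Fc xstar)
        ≤ ⟪gradFbar gF (V ω), DGbar DG (x ω) (w ω)⟫ := by
    have herr : |⟪gradFbar gF (V ω) - gradFbar gF (Gbar Gc (x ω)), DGbar DG (x ω) (w ω)⟫|
        ≤ LF * ‖V ω - Gbar Gc (x ω)‖ * (BG * ‖w ω‖) :=
      (abs_real_inner_le_norm _ _).trans (mul_le_mul (hgradFlip _ _)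
        ((DGbar DG (x ω)).le_of_opNorm_le (hDGbarb _) _) (norm_nonneg _) (by positivity))
    rw [inner_sub_left] at herr
    have hy := neg_young_le (p := ‖V ω - Gbar Gc (x ω)‖) (q := ‖w ω‖) (c := BG * LF) hμf
    rw [mul_pow, ← mul_assoc] at hy
    have hw0 : 0 ≤ μf * ‖w ω‖ ^ 2 := by positivity
    linarith [hconv ω, hxstar (x ω), (abs_le.1 herr).1]
  have hsq_int : Integrable (fun ω => ‖V ω - Gbar Gc (x ω)‖ ^ 2) μ :=
    (hV.sub hGx).integrable_norm_pow two_ne_zero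
  calc _ = ∫ ω, ⟪gradFbar gF (V ω), DGbar DG (x ω) (w ω)⟫ ∂μ :=
        (integral_congr_ae (ae_of_all _ hinner)).trans (hmean_i.trans hmean)
    _ ≥ ∫ ω, (-(8 * BG ^ 2 * LF ^ 2 / μf) * ‖V ω - Gbar Gc (x ω)‖ ^ 2
        + 3 / 4 * (fObj Gc Fc (x ω) - fObj Gc Fc xstar)) ∂μ :=
        integral_mono ((hsq_int.const_mul _).add (hf_int.const_mul _))
          (MemLp.integrable_inner_of_two hU hSx) hpoint
    _ = _ := by
        rw [integral_add (hsq_int.const_mul _) (hf_int.const_mul _), integral_const_mul,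
          integral_const_mul]
end
end
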